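/- arXiv:2407.10392 — 2 statements merged into one kernel-verified Lean document; each statement's English description precedes it below -/
import Mathlib

section
/- Let A_1, …, A_p be real analytic functions on an open neighborhood 𝒰 of 0 in ℝⁿ, and let X := {x ∈ 𝒰 : A_i(x) = 0 for i = 1, …, p}. Let W ⊆ 𝒰 be the common zero set of finitely many real analytic functions on 𝒰, with 0 ∈ W, and set X⁻ := X ∖ (X ∩ W). Then either (i) there is an open neighborhood 𝒰′ ⊆ 𝒰 of 0 such that X⁻ ∩ 𝒰′ = ∅, or (ii) X⁻ contains the image of a nonconstant real analytic map γ : (−1, 1) → ℝⁿ. -/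
open Set

namespace ArcSel
open Polynomial Filter Topology

lemma kappa_aux (a b r r' : ℝ) (har : a < r') (hrr : r' ≤ r) (hrb : r < b) :
    ∃ κ : ℝ ≃o ℝ, (∀ t, t ≤ a → κ t = t) ∧ (∀ t, b ≤ t → κ t = t) ∧ κ r = r' := by
  have h1 : 0 < r - a := by linarith
  have h2 : 0 < b - r := by linarith
  set m1 := (r' - a) / (r - a) with hm1
  set m2 := (b - r') / (b - r) with hm2
  have m1pos : 0 < m1 := div_pos (by linarith) h1
  have m1le : m1 ≤ 1 := by rw [hm1, div_le_one h1]; linarith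
  have m2ge : 1 ≤ m2 := by rw [hm2, le_div_iff₀ h2]; linarith
  set f : ℝ → ℝ := fun t => min t (max (a + (t - a) * m1) (b + (t - b) * m2)) with hf
  have fa : ∀ t, t ≤ a → f t = t := by
    intro t ht
    apply min_eq_left
    apply le_max_of_le_left
    nlinarith
  have fb : ∀ t, b ≤ t → f t = t := by
    intro t ht
    apply min_eq_left
    apply le_max_of_le_right
    nlinarith
  have fr : f r = r' := by
    have e1 : a + (r - a) * m1 = r' := by rw [hm1]; field_simp; ring
    have e2 : b + (r - b) * m2 = r' := by rw [hm2]; field_simp; ring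
    simp only [hf, e1, e2, max_self]
    exact min_eq_right hrr
  have hmono : StrictMono f := by
    intro s t hst
    have i1 : a + (s - a) * m1 < a + (t - a) * m1 := by nlinarith
    have i2 : b + (s - b) * m2 < b + (t - b) * m2 := by nlinarith
    exact min_lt_min hst (max_lt_max i1 i2)
  have hcont : Continuous f := by
    simp only [hf]; fun_prop
  have hsurj : Function.Surjective f := by
    apply hcont.surjective
    · refine tendsto_id.congr' ?_
      filter_upwards [eventually_ge_atTop b] with t ht using (fb t ht).symm
    · refine tendsto_id.congr' ?_
      filter_upwards [eventually_le_atBot a] with t ht using (fa t ht).symm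
  exact ⟨hmono.orderIsoOfSurjective f hsurj, fa, fb, fr⟩

lemma kappa (a b r r' : ℝ) (har : a < r) (hrb : r < b) (har' : a < r') (hrb' : r' < b) :
    ∃ κ : ℝ ≃o ℝ, (∀ t, t ≤ a → κ t = t) ∧ (∀ t, b ≤ t → κ t = t) ∧ κ r = r' := by
  rcases le_total r' r with h | h
  · exact kappa_aux a b r r' har' h hrb
  · obtain ⟨κ, h1, h2, h3⟩ := kappa_aux a b r' r har h hrb'
    refine ⟨κ.symm, fun t ht => ?_, fun t ht => ?_, ?_⟩
    · rw [OrderIso.symm_apply_eq, h1 t ht]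
    · rw [OrderIso.symm_apply_eq, h2 t ht]
    · rw [OrderIso.symm_apply_eq, h3]

lemma local_match_mono (g h : ℝ → ℝ) (a b : ℝ) (hab : a < b)
    (hg : ContinuousOn g (Icc a b)) (hh : ContinuousOn h (Icc a b))
    (mg : StrictMonoOn g (Icc a b)) (mh : StrictMonoOn h (Icc a b))
    (sa : SignType.sign (g a) = SignType.sign (h a))
    (sb : SignType.sign (g b) = SignType.sign (h b)) :
    ∃ κ : ℝ ≃o ℝ, (∀ t, t ≤ a → κ t = t) ∧ (∀ t, b ≤ t → κ t = t) ∧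
      ∀ t ∈ Icc a b, SignType.sign (g t) = SignType.sign (h (κ t)) := by
  have ha : a ∈ Icc a b := ⟨le_rfl, hab.le⟩
  have hb : b ∈ Icc a b := ⟨hab.le, le_rfl⟩
  by_cases h1 : 0 ≤ g a
  · refine ⟨OrderIso.refl ℝ, fun _ _ => rfl, fun _ _ => rfl, fun t ht => ?_⟩
    have h1' : 0 ≤ h a := by
      rw [← sign_nonneg_iff, ← sa, sign_nonneg_iff]; exact h1
    rcases ht.1.eq_or_lt with rfl | hlt
    · exact sa
    · have := mg ha ht hlt
      have := mh ha ht hlt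
      rw [OrderIso.refl_apply, sign_pos (by linarith), sign_pos (by linarith)]
  by_cases h2 : g b ≤ 0
  · refine ⟨OrderIso.refl ℝ, fun _ _ => rfl, fun _ _ => rfl, fun t ht => ?_⟩
    have h2' : h b ≤ 0 := by
      rw [← sign_nonpos_iff, ← sb, sign_nonpos_iff]; exact h2
    rcases ht.2.eq_or_lt with rfl | hlt
    · exact sb
    · have := mg ht hb hlt
      have := mh ht hb hlt
      rw [OrderIso.refl_apply, sign_neg (by linarith), sign_neg (by linarith)]
  push Not at h1 h2
  have h1' : h a < 0 := by
    rw [← sign_eq_neg_one_iff, ← sa, sign_eq_neg_one_iff]; exact h1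
  have h2' : 0 < h b := by
    rw [← sign_eq_one_iff, ← sb, sign_eq_one_iff]; exact h2
  obtain ⟨r, hr, hr0⟩ := intermediate_value_Ioo hab.le hg ⟨h1, h2⟩
  obtain ⟨r', hr', hr0'⟩ := intermediate_value_Ioo hab.le hh ⟨h1', h2'⟩
  obtain ⟨κ, k1, k2, k3⟩ := kappa a b r r' hr.1 hr.2 hr'.1 hr'.2
  refine ⟨κ, k1, k2, fun t ht => ?_⟩
  have hkt : κ t ∈ Icc a b := by
    constructor
    · rw [← k1 a le_rfl]; exact κ.monotone ht.1
    · rw [← k2 b le_rfl]; exact κ.monotone ht.2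
  have hrI : r ∈ Icc a b := Ioo_subset_Icc_self hr
  have hrI' : r' ∈ Icc a b := Ioo_subset_Icc_self hr'
  rcases lt_trichotomy t r with hlt | rfl | hlt
  · have e1 := mg ht hrI hlt
    have e2 := mh hkt hrI' (k3 ▸ κ.strictMono hlt)
    rw [sign_neg (by linarith), sign_neg (by linarith)]
  · rw [k3, hr0, hr0']
  · have e1 := mg hrI ht hlt
    have e2 := mh hrI' hkt (k3 ▸ κ.strictMono hlt)
    rw [sign_pos (by linarith), sign_pos (by linarith)]

lemma local_match (g h : ℝ → ℝ) (a b : ℝ) (hab : a < b)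
    (hg : ContinuousOn g (Icc a b)) (hh : ContinuousOn h (Icc a b))
    (m : (StrictMonoOn g (Icc a b) ∧ StrictMonoOn h (Icc a b)) ∨
      (StrictAntiOn g (Icc a b) ∧ StrictAntiOn h (Icc a b)))
    (sa : SignType.sign (g a) = SignType.sign (h a))
    (sb : SignType.sign (g b) = SignType.sign (h b)) :
    ∃ κ : ℝ ≃o ℝ, (∀ t, t ≤ a → κ t = t) ∧ (∀ t, b ≤ t → κ t = t) ∧
      ∀ t ∈ Icc a b, SignType.sign (g t) = SignType.sign (h (κ t)) := by
  rcases m with ⟨m1, m2⟩ | ⟨m1, m2⟩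
  · exact local_match_mono g h a b hab hg hh m1 m2 sa sb
  · obtain ⟨κ, k1, k2, k3⟩ := local_match_mono (fun t => - g t) (fun t => - h t) a b hab hg.neg
      hh.neg (fun x hx y hy hxy => neg_lt_neg (m1 hx hy hxy))
      (fun x hx y hy hxy => neg_lt_neg (m2 hx hy hxy))
      (by simp only [Left.sign_neg, sa]) (by simp only [Left.sign_neg, sb])
    refine ⟨κ, k1, k2, fun t ht => ?_⟩
    have := k3 t ht
    simp only [Left.sign_neg, neg_inj] at this
    exact this

lemma glue (g h : ℝ → ℝ) (hg : Continuous g) (hh : Continuous h) (Z : Finset ℝ)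
    (hs : ∀ z ∈ Z, SignType.sign (g z) = SignType.sign (h z))
    (hm : ∀ a ∈ Z, ∀ b ∈ Z, a < b → (∀ z ∈ Z, z ≤ a ∨ b ≤ z) →
      (StrictMonoOn g (Icc a b) ∧ StrictMonoOn h (Icc a b)) ∨
      (StrictAntiOn g (Icc a b) ∧ StrictAntiOn h (Icc a b))) :
    ∃ θ : ℝ ≃o ℝ, (∀ z ∈ Z, θ z = z) ∧ (∀ t, (∀ z ∈ Z, z ≤ t) → θ t = t) ∧
      ∀ t, (∃ z ∈ Z, z ≤ t) → (∃ z ∈ Z, t ≤ z) →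
        SignType.sign (g t) = SignType.sign (h (θ t)) := by
  induction Z using Finset.induction_on_max with
  | empty => exact ⟨OrderIso.refl ℝ, by simp, fun _ _ => rfl, by simp⟩
  | insert m Z hlt ih =>
    obtain ⟨θ, t1, t2, t3⟩ := ih (fun z hz => hs z (Finset.mem_insert_of_mem hz))
      (fun a ha b hb hab hz => hm a (Finset.mem_insert_of_mem ha) b (Finset.mem_insert_of_mem hb)
        hab (by
          intro z hzz
          rcases Finset.mem_insert.1 hzz with rfl | h
          · right; exact (hlt b hb).le
          · exact hz z h))
    rcases Z.eq_empty_or_nonempty with rfl | hne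
    · refine ⟨OrderIso.refl ℝ, fun _ _ => rfl, fun _ _ => rfl, ?_⟩
      rintro t ⟨z, hz, hzt⟩ ⟨z', hz', hzt'⟩
      simp at hz hz'
      have : t = m := by linarith
      rw [this]
      exact hs m (by simp)
    · set c := Z.max' hne
      have hcZ : c ∈ Z := Z.max'_mem hne
      have hcmax : ∀ z ∈ Z, z ≤ c := fun z hz => Z.le_max' z hz
      have hcm : c < m := hlt c hcZ
      obtain ⟨κ, k1, k2, k3⟩ := local_match g h c m hcm hg.continuousOn hh.continuousOn
        (hm c (Finset.mem_insert_of_mem hcZ) m (Finset.mem_insert_self _ _) hcm (by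
          intro z hz
          rcases Finset.mem_insert.1 hz with rfl | h
          · right; exact le_rfl
          · left; exact hcmax z h))
        (hs c (Finset.mem_insert_of_mem hcZ)) (hs m (Finset.mem_insert_self _ _))
      have hth : ∀ t, c ≤ t → θ t = t := fun t ht => t2 t (fun z hz => (hcmax z hz).trans ht)
      refine ⟨κ.trans θ, ?_, ?_, ?_⟩
      · intro z hz
        rw [OrderIso.trans_apply]
        rcases Finset.mem_insert.1 hz with rfl | h
        · rw [k2 z le_rfl, hth z hcm.le]
        · rw [k1 z (hcmax z h), t1 z h]
      · intro t ht
        have : m ≤ t := ht m (Finset.mem_insert_self _ _)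
        rw [OrderIso.trans_apply, k2 t this, hth t (hcm.le.trans this)]
      · rintro t ⟨z, hz, hzt⟩ ⟨z', hz', hzt'⟩
        rw [OrderIso.trans_apply]
        rcases le_total t c with htc | htc
        · rw [k1 t htc]
          refine t3 t ?_ ⟨c, hcZ, htc⟩
          rcases Finset.mem_insert.1 hz with rfl | h
          · linarith
          · exact ⟨z, h, hzt⟩
        · have htm : t ≤ m := by
            rcases Finset.mem_insert.1 hz' with rfl | h
            · exact hzt'
            · linarith [hlt z' h]
          have : c ≤ κ t := by rw [← k1 c le_rfl]; exact κ.monotone htc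
          rw [hth _ this]
          exact k3 t ⟨htc, htm⟩

/-- Pseudo-division. -/
lemma exists_prem {R : Type*} [CommRing R] (p q : R[X]) (hq : 1 ≤ q.natDegree) :
    ∃ (e : ℕ) (s r : R[X]), C q.leadingCoeff ^ e * p = q * s + r ∧ r.natDegree < q.natDegree := by
  induction hn : p.natDegree using Nat.strong_induction_on generalizing p with
  | _ n ih =>
    by_cases hlt : p.natDegree < q.natDegree
    · exact ⟨0, 0, p, by simp, hlt⟩
    push Not at hlt
    set p1 := C q.leadingCoeff * p - q * (C p.leadingCoeff * X ^ (p.natDegree - q.natDegree)) with hp1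
    have hdeg : p1.natDegree < p.natDegree := by
      have hle : p1.natDegree ≤ p.natDegree := by
        refine (natDegree_sub_le _ _).trans (max_le ?_ ?_)
        · exact natDegree_C_mul_le _ _
        · refine natDegree_mul_le.trans ?_
          have := natDegree_C_mul_X_pow_le p.leadingCoeff (p.natDegree - q.natDegree)
          omega
      refine lt_of_le_of_ne hle fun heq => ?_
      have h0 : p1.coeff p.natDegree = 0 := by
        rw [hp1, coeff_sub, coeff_C_mul, ← mul_assoc, coeff_mul_X_pow', if_pos (Nat.sub_le _ _),
          Nat.sub_sub_self hlt, coeff_mul_C]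
        simp only [leadingCoeff]; ring
      rw [← heq] at h0
      have : p1 = 0 := leadingCoeff_eq_zero.1 h0
      rw [this] at heq
      simp at heq; omega
    obtain ⟨e, s, r, h1, h2⟩ := ih p1.natDegree (hn ▸ hdeg) p1 rfl
    refine ⟨e + 1, s + C q.leadingCoeff ^ e * (C p.leadingCoeff * X ^ (p.natDegree - q.natDegree)),
      r, ?_, h2⟩
    rw [hp1] at h1
    linear_combination h1

/-- Closure property above degree `k`. -/
def ClosedAbove {R : Type*} [CommRing R] (d : R) (S : Finset R[X]) (k : ℕ) : Prop :=
  ∀ p ∈ S, k ≤ p.natDegree → 1 ≤ p.natDegree →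
    derivative p ∈ S ∧ p.eraseLead ∈ S ∧ C p.leadingCoeff ∈ S ∧ C (p.eval d) ∈ S ∧
    C (p.eval (-d)) ∈ S ∧
    ∀ p' ∈ S, p.natDegree ≤ p'.natDegree → ∃ (e : ℕ) (s r : R[X]),
      C p.leadingCoeff ^ e * p' = p * s + r ∧ r.natDegree < p.natDegree ∧ r ∈ S

lemma exists_closed {R : Type*} [CommRing R] (d : R) (L : Finset R[X]) :
    ∃ S : Finset R[X], L ⊆ S ∧ ClosedAbove d S 0 := by
  classical
  set D := L.sup natDegree + 1 with hD
  have key : ∀ j, j ≤ D → ∃ S : Finset R[X], L ⊆ S ∧ ClosedAbove d S (D - j) := by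
    intro j
    induction j with
    | zero =>
      intro _
      refine ⟨L, le_rfl, fun p hp hk => ?_⟩
      have : p.natDegree ≤ L.sup natDegree := Finset.le_sup hp
      omega
    | succ j ih =>
      intro hj
      obtain ⟨S, hLS, hS⟩ := ih (by omega)
      choose! e s r hr1 hr2 using fun (p q : R[X]) => exists_prem (R := R) p q
      set k := D - (j + 1) with hk
      set Q := S.filter (fun p => k ≤ p.natDegree ∧ 1 ≤ p.natDegree) with hQ
      set N : Finset R[X] := Q.image derivative ∪ Q.image eraseLead ∪
        Q.image (fun p => C p.leadingCoeff) ∪ Q.image (fun p => C (p.eval d)) ∪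
        Q.image (fun p => C (p.eval (-d))) ∪
        ((S ×ˢ Q).filter (fun x => x.2.natDegree = k)).image (fun x => r x.1 x.2) with hN
      have hNdeg : ∀ p ∈ N, 1 ≤ p.natDegree → k ≤ p.natDegree → p ∈ S := by
        intro p hp h1 hkp
        simp only [hN, Finset.mem_union, Finset.mem_image, Finset.mem_filter,
          Finset.mem_product, hQ] at hp
        rcases hp with ((((⟨a, ⟨ha, hka, h1a⟩, rfl⟩ | ⟨a, ⟨ha, hka, h1a⟩, rfl⟩) |
          ⟨a, ⟨ha, hka, h1a⟩, rfl⟩) | ⟨a, ⟨ha, hka, h1a⟩, rfl⟩) | ⟨a, ⟨ha, hka, h1a⟩, rfl⟩) |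
          ⟨⟨a, b⟩, ⟨⟨ha, hb, hkb, h1b⟩, hbk⟩, rfl⟩
        · by_cases hak : a.natDegree = k
          · have := natDegree_derivative_lt (p := a) (by omega)
            omega
          · exact (hS a ha (by omega) h1a).1
        · by_cases hak : a.natDegree = k
          · have := eraseLead_natDegree_le a
            omega
          · exact (hS a ha (by omega) h1a).2.1
        · simp at h1
        · simp at h1
        · simp at h1
        · have := hr2 a b h1b
          simp only at hbk hkp
          omega
      refine ⟨S ∪ N, hLS.trans Finset.subset_union_left, fun p hp hkp h1p => ?_⟩
      have hpS : p ∈ S := by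
        rcases Finset.mem_union.1 hp with h | h
        · exact h
        · exact hNdeg p h h1p hkp
      have hpQ : p ∈ Q := by simp [hQ, hpS, hkp, h1p]
      refine ⟨?_, ?_, ?_, ?_, ?_, ?_⟩
      · apply Finset.mem_union_right; simp only [hN, Finset.mem_union, Finset.mem_image]
        exact Or.inl (Or.inl (Or.inl (Or.inl (Or.inl ⟨p, hpQ, rfl⟩))))
      · apply Finset.mem_union_right; simp only [hN, Finset.mem_union, Finset.mem_image]
        exact Or.inl (Or.inl (Or.inl (Or.inl (Or.inr ⟨p, hpQ, rfl⟩))))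
      · apply Finset.mem_union_right; simp only [hN, Finset.mem_union, Finset.mem_image]
        exact Or.inl (Or.inl (Or.inl (Or.inr ⟨p, hpQ, rfl⟩)))
      · apply Finset.mem_union_right; simp only [hN, Finset.mem_union, Finset.mem_image]
        exact Or.inl (Or.inl (Or.inr ⟨p, hpQ, rfl⟩))
      · apply Finset.mem_union_right; simp only [hN, Finset.mem_union, Finset.mem_image]
        exact Or.inl (Or.inr ⟨p, hpQ, rfl⟩)
      · intro p' hp' hle
        have hp'S : p' ∈ S := by
          rcases Finset.mem_union.1 hp' with h | h
          · exact h
          · exact hNdeg p' h (by omega) (by omega)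
        by_cases hpk : p.natDegree = k
        · refine ⟨e p' p, s p' p, r p' p, hr1 p' p h1p, hr2 p' p h1p, ?_⟩
          apply Finset.mem_union_right; simp only [hN, Finset.mem_union, Finset.mem_image]
          refine Or.inr ⟨(p', p), ?_, rfl⟩
          simp [hp'S, hpQ, hpk]
        · obtain ⟨e', s', r', g1, g2, g3⟩ := (hS p hpS (by omega) h1p).2.2.2.2.2 p' hp'S hle
          exact ⟨e', s', r', g1, g2, Finset.mem_union_left _ g3⟩
  obtain ⟨S, h1, h2⟩ := key D le_rfl
  exact ⟨S, h1, by simpa using h2⟩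

lemma hormander_aux {R : Type*} [CommRing R] (d : R) (S : Finset R[X]) (hS : ClosedAbove d S 0)
    (u v : R →+* ℝ) (D : ℝ) (hD : 0 < D) (hu : u d = D) (hv : v d = D)
    (hc : ∀ p ∈ S, p.natDegree = 0 →
      SignType.sign (u (p.coeff 0)) = SignType.sign (v (p.coeff 0))) :
    ∀ F : Finset R[X], F ⊆ S → (∀ p ∈ F, ∀ q ∈ S, q.natDegree < p.natDegree → q ∈ F) →
    ∃ φ : ℝ ≃o ℝ, φ D = D ∧ φ (-D) = -D ∧ ∀ p ∈ F, ∀ t ∈ Icc (-D) D,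
      SignType.sign ((p.map u).eval t) = SignType.sign ((p.map v).eval (φ t)) := by
  classical
  have hcC : ∀ c : R, C c ∈ S → SignType.sign (u c) = SignType.sign (v c) := by
    intro c hcS
    simpa using hc (C c) hcS (natDegree_C c)
  have hconst : ∀ (w : R →+* ℝ) (p : R[X]), p.natDegree = 0 → ∀ t, (p.map w).eval t = w (p.coeff 0) := by
    intro w p hp t
    rw [eq_C_of_natDegree_eq_zero hp]; simp
  have herase : ∀ (w : R →+* ℝ) (p : R[X]), w p.leadingCoeff = 0 → p.eraseLead.map w = p.map w := by
    intro w p hp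
    have := congrArg (Polynomial.map w) (eraseLead_add_C_mul_X_pow p)
    rw [Polynomial.map_add, Polynomial.map_mul, map_C, hp, C_0, zero_mul, add_zero] at this
    exact this
  intro F
  induction F using Finset.induction_on_max_value (fun p : R[X] => p.natDegree) with
  | empty => intro _ _; exact ⟨OrderIso.refl ℝ, rfl, rfl, by simp⟩
  | insert p F hpF hmax ih =>
    intro hFS hdown
    have hpS : p ∈ S := hFS (Finset.mem_insert_self _ _)
    have hFS' : F ⊆ S := fun q hq => hFS (Finset.mem_insert_of_mem hq)
    obtain ⟨φ, φ1, φ2, φ3⟩ := ih hFS' (by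
      intro p' hp' q hq hlt
      rcases Finset.mem_insert.1 (hdown p' (Finset.mem_insert_of_mem hp') q hq hlt) with rfl | h
      · exact absurd hlt (not_lt.2 (hmax p' hp'))
      · exact h)
    have hlow : ∀ q ∈ S, q.natDegree < p.natDegree → q ∈ F := by
      intro q hq hlt
      rcases Finset.mem_insert.1 (hdown p (Finset.mem_insert_self _ _) q hq hlt) with rfl | h
      · exact absurd hlt (lt_irrefl _)
      · exact h
    by_cases hn0 : p.natDegree = 0
    · refine ⟨φ, φ1, φ2, fun q hq t ht => ?_⟩
      rcases Finset.mem_insert.1 hq with rfl | h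
      · rw [hconst u q hn0, hconst v q hn0]; exact hc q hpS hn0
      · exact φ3 q h t ht
    have hn1 : 1 ≤ p.natDegree := by omega
    obtain ⟨c1, c2, c3, c4, c5, c6⟩ := hS p hpS (Nat.zero_le _) hn1
    by_cases hlead : u p.leadingCoeff = 0
    · have hlead' : v p.leadingCoeff = 0 := by
        rw [← sign_eq_zero_iff, ← hcC _ c3, hlead, sign_zero]
      refine ⟨φ, φ1, φ2, fun q hq t ht => ?_⟩
      rcases Finset.mem_insert.1 hq with rfl | h
      · rw [← herase u q hlead, ← herase v q hlead']
        refine φ3 _ (hlow _ c2 ?_) t ht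
        have := eraseLead_natDegree_le q
        omega
      · exact φ3 q h t ht
    have hdF : derivative p ∈ F := hlow _ c1 (natDegree_derivative_lt hn0)
    set g : ℝ → ℝ := fun t => (p.map u).eval t with hg
    set h : ℝ → ℝ := fun t => (p.map v).eval (φ t) with hh
    set Z : Finset ℝ := insert D (insert (-D) ((F.biUnion (fun q => (q.map u).roots.toFinset)).filter
      (fun t => t ∈ Icc (-D) D))) with hZ
    have hZI : ∀ z ∈ Z, z ∈ Icc (-D) D := by
      intro z hz
      simp only [hZ, Finset.mem_insert, Finset.mem_filter] at hz
      rcases hz with rfl | rfl | hz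
      · constructor <;> linarith
      · constructor <;> linarith
      · exact hz.2
    have hDZ : D ∈ Z := by simp [hZ]
    have hDZ' : -D ∈ Z := by simp [hZ]
    have hZmem : ∀ q ∈ F, q.map u ≠ 0 → ∀ t ∈ Icc (-D) D, (q.map u).eval t = 0 → t ∈ Z := by
      intro q hq hq0 t ht h0
      simp only [hZ, Finset.mem_insert, Finset.mem_filter, Finset.mem_biUnion, Multiset.mem_toFinset]
      right; right
      exact ⟨⟨q, hq, (mem_roots hq0).2 h0⟩, ht⟩
    have hsZ : ∀ z ∈ Z, SignType.sign (g z) = SignType.sign (h z) := by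
      intro z hz
      have hzI := hZI z hz
      simp only [hZ, Finset.mem_insert, Finset.mem_filter, Finset.mem_biUnion,
        Multiset.mem_toFinset] at hz
      rcases hz with rfl | rfl | ⟨⟨q, hq, hqr⟩, -⟩
      · have := hcC _ c4
        simp only [hg, hh, φ1]
        rw [← hu, eval_map, eval₂_at_apply, hu, ← hv, eval_map, eval₂_at_apply]
        exact this
      · have := hcC _ c5
        simp only [hg, hh, φ2]
        have e1 : -D = u (-d) := by simp [hu]
        have e2 : -D = v (-d) := by simp [hv]
        rw [e1, eval_map, eval₂_at_apply, ← e1, e2, eval_map, eval₂_at_apply]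
        exact this
      · have hex : ∃ N, ∃ q ∈ F, q.natDegree = N ∧ q.map u ≠ 0 ∧ (q.map u).eval z = 0 := by
          have hq0 : q.map u ≠ 0 := fun h => by simp [h] at hqr
          exact ⟨_, q, hq, rfl, hq0, (mem_roots hq0).1 hqr⟩
        obtain ⟨q, hqF, hqN, hq0, hqz⟩ := Nat.find_spec hex
        have hmin := fun {m} => Nat.find_min (m := m) hex
        rw [← hqN] at hmin
        have hqd : 1 ≤ q.natDegree := by
          by_contra hlt
          have h0 : q.natDegree = 0 := by omega
          apply hq0
          rw [hconst u q h0] at hqz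
          rw [eq_C_of_natDegree_eq_zero h0]; simp [hqz]
        obtain ⟨d1, d2, d3, d4, d5, d6⟩ := hS q (hFS' hqF) (Nat.zero_le _) hqd
        have hql : u q.leadingCoeff ≠ 0 := by
          intro h0
          have e1 := herase u q h0
          have e2 := eraseLead_natDegree_le q
          refine hmin (m := q.eraseLead.natDegree) (by omega) ⟨q.eraseLead, ?_, rfl, ?_, ?_⟩
          · exact hlow _ d2 (by have := hmax q hqF; omega)
          · rwa [e1]
          · rwa [e1]
        obtain ⟨e, s, r, r1, r2, r3⟩ := d6 p hpS (hmax q hqF)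
        have hrF : r ∈ F := hlow r r3 (lt_of_lt_of_le r2 (hmax q hqF))
        have hqz' : (q.map v).eval (φ z) = 0 := by
          have := φ3 q hqF z hzI
          rw [hqz, sign_zero] at this
          exact sign_eq_zero_iff.1 this.symm
        have E1 : u q.leadingCoeff ^ e * g z = (r.map u).eval z := by
          have := congrArg (fun w => (w.map u).eval z) r1
          simpa [hqz, hg] using this
        have E2 : v q.leadingCoeff ^ e * h z = (r.map v).eval (φ z) := by
          have := congrArg (fun w => (w.map v).eval (φ z)) r1
          simpa [hqz', hh] using this
        have E3 := φ3 r hrF z hzI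
        rw [← E1, ← E2, sign_mul, sign_mul, sign_pow, sign_pow, ← hcC _ d3] at E3
        refine mul_left_cancel₀ ?_ E3
        exact pow_ne_zero _ (by simpa [sign_eq_zero_iff] using hql)
    have hdne : derivative (p.map u) ≠ 0 := by
      intro h0
      have h1 := Polynomial.derivative_eq_zero.1 h0
      rw [natDegree_map_of_leadingCoeff_ne_zero u hlead] at h1
      omega
    have hmZ : ∀ a ∈ Z, ∀ b ∈ Z, a < b → (∀ z ∈ Z, z ≤ a ∨ b ≤ z) →
        (StrictMonoOn g (Icc a b) ∧ StrictMonoOn h (Icc a b)) ∨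
        (StrictAntiOn g (Icc a b) ∧ StrictAntiOn h (Icc a b)) := by
      intro a ha b hb hab hcons
      have hsub : Ioo a b ⊆ Icc (-D) D := fun t ht =>
        ⟨(hZI a ha).1.trans ht.1.le, ht.2.le.trans (hZI b hb).2⟩
      have hnz : ∀ t ∈ Ioo a b, (derivative (p.map u)).eval t ≠ 0 := by
        intro t ht h0
        have : t ∈ Z := by
          refine hZmem _ hdF ?_ t (hsub ht) ?_
          · rwa [← derivative_map]
          · rwa [← derivative_map]
        rcases hcons t this with h | h
        · exact absurd ht.1 (not_lt.2 h)
        · exact absurd ht.2 (not_lt.2 h)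
      have hsg : ∀ t ∈ Ioo a b, SignType.sign ((derivative (p.map u)).eval t) =
          SignType.sign ((derivative (p.map v)).eval (φ t)) := by
        intro t ht
        have := φ3 _ hdF t (hsub ht)
        rwa [← derivative_map, ← derivative_map] at this
      have hφI : ∀ x ∈ Ioo (φ a) (φ b), φ.symm x ∈ Ioo a b := by
        intro x hx
        constructor
        · rw [← φ.lt_iff_lt, OrderIso.apply_symm_apply]; exact hx.1
        · rw [← φ.lt_iff_lt, OrderIso.apply_symm_apply]; exact hx.2
      have hmaps : ∀ x ∈ Icc a b, φ x ∈ Icc (φ a) (φ b) := fun x hx =>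
        ⟨φ.monotone hx.1, φ.monotone hx.2⟩
      have hpos_or : (∀ t ∈ Ioo a b, 0 < (derivative (p.map u)).eval t) ∨
          (∀ t ∈ Ioo a b, (derivative (p.map u)).eval t < 0) := by
        by_contra hcon
        push Not at hcon
        obtain ⟨⟨x, hx, hx0⟩, y, hy, hy0⟩ := hcon
        obtain ⟨z, hz, hz0⟩ := (isPreconnected_Ioo (a := a) (b := b)).intermediate_value hx hy
          (derivative (p.map u)).continuous.continuousOn ⟨hx0, hy0⟩
        exact hnz z hz hz0
      rcases hpos_or with hpos | hneg
      · left
        constructor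
        · refine strictMonoOn_of_deriv_pos (convex_Icc a b) (p.map u).continuous.continuousOn ?_
          intro t ht
          rw [interior_Icc] at ht
          rw [Polynomial.deriv]; exact hpos t ht
        · have : StrictMonoOn (fun t => (p.map v).eval t) (Icc (φ a) (φ b)) := by
            refine strictMonoOn_of_deriv_pos (convex_Icc _ _) (p.map v).continuous.continuousOn ?_
            intro t ht
            rw [interior_Icc] at ht
            have h1 := hsg _ (hφI t ht)
            rw [OrderIso.apply_symm_apply, sign_pos (hpos _ (hφI t ht))] at h1
            rw [Polynomial.deriv]; exact sign_eq_one_iff.1 h1.symm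
          exact fun x hx y hy hxy => this (hmaps x hx) (hmaps y hy) (φ.strictMono hxy)
      · right
        constructor
        · refine strictAntiOn_of_deriv_neg (convex_Icc a b) (p.map u).continuous.continuousOn ?_
          intro t ht
          rw [interior_Icc] at ht
          rw [Polynomial.deriv]; exact hneg t ht
        · have : StrictAntiOn (fun t => (p.map v).eval t) (Icc (φ a) (φ b)) := by
            refine strictAntiOn_of_deriv_neg (convex_Icc _ _) (p.map v).continuous.continuousOn ?_
            intro t ht
            rw [interior_Icc] at ht
            have h1 := hsg _ (hφI t ht)
            rw [OrderIso.apply_symm_apply, sign_neg (hneg _ (hφI t ht))] at h1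
            rw [Polynomial.deriv]; exact sign_eq_neg_one_iff.1 h1.symm
          exact fun x hx y hy hxy => this (hmaps x hx) (hmaps y hy) (φ.strictMono hxy)
    obtain ⟨θ, t1, t2, t3⟩ := glue g h (p.map u).continuous
      ((p.map v).continuous.comp φ.continuous) Z hsZ hmZ
    have hθI : ∀ t ∈ Icc (-D) D, θ t ∈ Icc (-D) D := by
      intro t ht
      constructor
      · rw [← t1 _ hDZ']; exact θ.monotone ht.1
      · rw [← t1 _ hDZ]; exact θ.monotone ht.2
    refine ⟨θ.trans φ, by simp [t1 _ hDZ, φ1], by simp [t1 _ hDZ', φ2], fun q hq t ht => ?_⟩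
    rw [OrderIso.trans_apply]
    rcases Finset.mem_insert.1 hq with rfl | hqF
    · exact t3 t ⟨_, hDZ', ht.1⟩ ⟨_, hDZ, ht.2⟩
    · rw [← φ3 q hqF _ (hθI t ht)]
      by_cases hq0 : q.map u = 0
      · simp [hq0]
      have hzz : ∀ z ∈ Z, (z = t ↔ z = θ t) := by
        intro z hz
        constructor
        · rintro rfl; exact (t1 z hz).symm
        · intro h1
          apply θ.injective
          rw [t1 z hz, h1]
      by_cases htz : (q.map u).eval t = 0
      · have : t ∈ Z := hZmem q hqF hq0 t ht htz
        rw [t1 t this]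
      have hno : ∀ z ∈ Set.uIcc t (θ t), (q.map u).eval z ≠ 0 := by
        intro z hz h0
        have hzI : z ∈ Icc (-D) D := by
          have := Set.uIcc_subset_Icc ht (hθI t ht)
          exact this hz
        have hzZ := hZmem q hqF hq0 z hzI h0
        have hzt := t1 z hzZ
        rcases Set.mem_uIcc.1 hz with ⟨h1, h2⟩ | ⟨h1, h2⟩
        · have h3 := θ.monotone h1
          rw [hzt] at h3
          have : z = θ t := le_antisymm h2 h3
          rw [(hzz z hzZ).2 this] at h0
          exact htz h0
        · have h3 := θ.monotone h2
          rw [hzt] at h3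
          have : z = θ t := le_antisymm h3 h1
          rw [(hzz z hzZ).2 this] at h0
          exact htz h0
      have hcon := (q.map u).continuous.continuousOn (s := Set.uIcc t (θ t))
      rcases lt_trichotomy ((q.map u).eval t) 0 with h1 | h1 | h1
      · rcases lt_trichotomy ((q.map u).eval (θ t)) 0 with h2 | h2 | h2
        · rw [sign_neg h1, sign_neg h2]
        · exact absurd h2 (hno _ Set.right_mem_uIcc)
        · obtain ⟨z, hz, hz0⟩ := isPreconnected_uIcc.intermediate_value
            Set.left_mem_uIcc Set.right_mem_uIcc hcon ⟨h1.le, h2.le⟩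
          exact absurd hz0 (hno z hz)
      · exact absurd h1 htz
      · rcases lt_trichotomy ((q.map u).eval (θ t)) 0 with h2 | h2 | h2
        · obtain ⟨z, hz, hz0⟩ := isPreconnected_uIcc.intermediate_value
            Set.right_mem_uIcc Set.left_mem_uIcc hcon ⟨h2.le, h1.le⟩
          exact absurd hz0 (hno z hz)
        · exact absurd h2 (hno _ Set.right_mem_uIcc)
        · rw [sign_pos h1, sign_pos h2]

/-- One-quantifier elimination: finitely many elements of the coefficient ring control the realized
sign conditions. -/
theorem elim {R : Type*} [CommRing R] (d : R) (L : Finset R[X]) :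
    ∃ K : Finset R, ∀ (u v : R →+* ℝ) (D : ℝ), 0 < D → u d = D → v d = D →
      (∀ c ∈ K, SignType.sign (u c) = SignType.sign (v c)) →
      ∀ t ∈ Icc (-D) D, ∃ t' ∈ Icc (-D) D, ∀ p ∈ L,
        SignType.sign ((p.map u).eval t) = SignType.sign ((p.map v).eval t') := by
  classical
  obtain ⟨S, hLS, hS⟩ := exists_closed d L
  refine ⟨S.image (fun p => p.coeff 0), fun u v D hD hu hv hK t ht => ?_⟩
  obtain ⟨φ, h1, h2, h3⟩ := hormander_aux d S hS u v D hD hu hv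
    (fun p hp _ => hK _ (Finset.mem_image_of_mem _ hp)) S le_rfl (fun _ _ q hq _ => hq)
  refine ⟨φ t, ⟨?_, ?_⟩, fun p hp => h3 p (hLS hp) t ht⟩
  · rw [← h2]; exact φ.monotone ht.1
  · rw [← h1]; exact φ.monotone ht.2
section FunctionalCalculus

open scoped NNReal ENNReal

variable {ι : Type} [Fintype ι] [DecidableEq ι]

/-- Extension of a real power series to a commutative Banach algebra. -/
noncomputable def extS (p : FormalMultilinearSeries ℝ (ι → ℝ) ℝ) (B : Type) [NormedCommRing B]
    [NormedAlgebra ℝ B] : FormalMultilinearSeries ℝ (ι → B) B :=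
  fun k => ∑ i : Fin k → ι, p k (fun j => Pi.single (i j) (1 : ℝ)) •
    (ContinuousMultilinearMap.mkPiAlgebraFin ℝ k B).compContinuousLinearMap
      (fun j => ContinuousLinearMap.proj (i j))

lemma extS_apply (p : FormalMultilinearSeries ℝ (ι → ℝ) ℝ) (B : Type) [NormedCommRing B]
    [NormedAlgebra ℝ B] (k : ℕ) (b : ι → B) :
    extS p B k (fun _ => b) =
      ∑ i : Fin k → ι, p k (fun j => Pi.single (i j) (1 : ℝ)) • ∏ j, b (i j) := by
  simp [extS, List.prod_ofFn]

lemma extS_norm_le (p : FormalMultilinearSeries ℝ (ι → ℝ) ℝ) (B : Type) [NormedCommRing B]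
    [NormedAlgebra ℝ B] [NormOneClass B] (k : ℕ) :
    ‖extS p B k‖ ≤ (Fintype.card ι : ℝ) ^ k * ‖p k‖ := by
  have : ∀ i : Fin k → ι, ‖p k (fun j => Pi.single (i j) (1 : ℝ)) •
    (ContinuousMultilinearMap.mkPiAlgebraFin ℝ k B).compContinuousLinearMap
      (fun j => ContinuousLinearMap.proj (R := ℝ) (φ := fun _ => B) (i j))‖ ≤ ‖p k‖ := by
    intro i
    rw [norm_smul]
    have h1 : ‖p k (fun j => Pi.single (i j) (1 : ℝ))‖ ≤ ‖p k‖ := by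
      refine ((p k).le_opNorm _).trans ?_
      rw [Finset.prod_eq_one, mul_one]
      intro j _
      rw [Pi.norm_single, norm_one]
    have h2 : ‖(ContinuousMultilinearMap.mkPiAlgebraFin ℝ k B).compContinuousLinearMap
      (fun j => ContinuousLinearMap.proj (R := ℝ) (φ := fun _ => B) (i j))‖ ≤ 1 := by
      refine (ContinuousMultilinearMap.norm_compContinuousLinearMap_le _ _).trans ?_
      rw [ContinuousMultilinearMap.norm_mkPiAlgebraFin, one_mul]
      refine Finset.prod_le_one (fun _ _ => norm_nonneg _) fun j _ => ?_
      refine ContinuousLinearMap.opNorm_le_bound _ zero_le_one fun x => ?_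
      rw [one_mul]; exact norm_le_pi_norm x (i j)
    calc _ ≤ ‖p k‖ * 1 := by gcongr
      _ = _ := mul_one _
  refine (norm_sum_le _ _).trans ((Finset.sum_le_sum fun i _ => this i).trans ?_)
  simp

lemma extS_radius (p : FormalMultilinearSeries ℝ (ι → ℝ) ℝ) (hp : 0 < p.radius) :
    ∃ r : ℝ≥0, 0 < r ∧ ∀ (B : Type) [NormedCommRing B] [NormedAlgebra ℝ B] [NormOneClass B],
      (r : ℝ≥0∞) ≤ (extS p B).radius := by
  obtain ⟨s, hs0, hs⟩ := ENNReal.lt_iff_exists_nnreal_btwn.1 hp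
  obtain ⟨C, hC, hb⟩ := p.norm_mul_pow_le_of_lt_radius hs
  have hs0' : 0 < s := by exact_mod_cast hs0
  refine ⟨s / (Fintype.card ι + 1), by positivity, fun B _ _ _ => ?_⟩
  refine FormalMultilinearSeries.le_radius_of_bound _ C fun k => ?_
  refine le_trans ?_ (hb k)
  push_cast
  calc ‖extS p B k‖ * ((s : ℝ) / (Fintype.card ι + 1)) ^ k
      ≤ ((Fintype.card ι : ℝ) ^ k * ‖p k‖) * ((s : ℝ) / (Fintype.card ι + 1)) ^ k := by
        gcongr; exact extS_norm_le p B k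
    _ = ‖p k‖ * ((Fintype.card ι : ℝ) * ((s : ℝ) / (Fintype.card ι + 1))) ^ k := by
        rw [mul_pow]; ring
    _ ≤ ‖p k‖ * (s : ℝ) ^ k := by
        gcongr
        rw [mul_div_assoc', div_le_iff₀ (by positivity)]
        have : (0:ℝ) ≤ s := s.2
        nlinarith

lemma extS_map (p : FormalMultilinearSeries ℝ (ι → ℝ) ℝ) (B B' : Type) [NormedCommRing B]
    [NormedAlgebra ℝ B] [NormedCommRing B'] [CompleteSpace B]
    [NormedAlgebra ℝ B'] (χ : B →ₐ[ℝ] B') (hχ : Continuous χ) (b : ι → B)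
    (hb : b ∈ Metric.eball (0 : ι → B) (extS p B).radius) :
    χ ((extS p B).sum b) = (extS p B').sum (fun i => χ (b i)) := by
  have h1 : HasSum (fun k => extS p B k (fun _ => b)) ((extS p B).sum b) :=
    (extS p B).hasSum hb
  have h2 := h1.map (χ : B →+ B') hχ
  rw [FormalMultilinearSeries.sum]
  refine (h2.tsum_eq.symm.trans ?_)
  congr 1
  ext k
  simp [extS_apply, map_sum, map_prod]

lemma extS_real (p : FormalMultilinearSeries ℝ (ι → ℝ) ℝ) (x : ι → ℝ) :
    (extS p ℝ).sum x = p.sum x := by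
  rw [FormalMultilinearSeries.sum, FormalMultilinearSeries.sum]
  congr 1
  ext k
  rw [extS_apply]
  have hx : x = ∑ i, x i • (Pi.single i (1 : ℝ) : ι → ℝ) := by
    ext j; simp [Finset.sum_apply, Pi.single_apply]
  have := (p k).toMultilinearMap.map_sum (fun (_ : Fin k) (i : ι) => x i • (Pi.single i (1 : ℝ) : ι → ℝ))
  rw [← hx] at this
  refine Eq.trans ?_ this.symm
  refine Finset.sum_congr rfl fun i _ => ?_
  rw [MultilinearMap.map_smul_univ, smul_eq_mul, smul_eq_mul, mul_comm]
  rfl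

end FunctionalCalculus

/-- The open unit disc. -/
abbrev Dk := Metric.ball (0 : ℂ) 1

/-- Extension by zero. -/
noncomputable def extz (f : Dk → ℂ) : ℂ → ℂ :=
  open Classical in fun z => if h : z ∈ Metric.ball (0 : ℂ) 1 then f ⟨z, h⟩ else 0

lemma extz_apply (f : Dk → ℂ) (z : Dk) : extz f z = f z := by
  have := z.2
  simp only [extz]
  rw [dif_pos this]

lemma extz_congr (f : Dk → ℂ) (F : ℂ → ℂ) (h : ∀ z : Dk, f z = F z) :
    EqOn (extz f) F (Metric.ball (0 : ℂ) 1) := by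
  intro z hz
  rw [extz_apply f ⟨z, hz⟩, h]

/-- Bounded holomorphic functions on the unit disc. -/
noncomputable def Hinf : Subalgebra ℝ (BoundedContinuousFunction Dk ℂ) where
  carrier := {f | DifferentiableOn ℂ (extz f) (Metric.ball (0 : ℂ) 1)}
  mul_mem' := by
    intro f g hf hg
    refine (DifferentiableOn.mul hf hg).congr (extz_congr _ _ fun z => ?_)
    simp [extz_apply]
  add_mem' := by
    intro f g hf hg
    refine (DifferentiableOn.add hf hg).congr (extz_congr _ _ fun z => ?_)
    simp [extz_apply]
  algebraMap_mem' := by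
    intro r
    refine (differentiableOn_const (r : ℂ)).congr (extz_congr _ _ fun z => ?_)
    rfl

lemma Hinf_closed : IsClosed (Hinf : Set (BoundedContinuousFunction Dk ℂ)) := by
  refine IsSeqClosed.isClosed fun u f hu hf => ?_
  show DifferentiableOn ℂ (extz f) (Metric.ball (0 : ℂ) 1)
  have : TendstoUniformlyOn (fun n => extz (u n)) (extz f) atTop (Metric.ball (0 : ℂ) 1) := by
    rw [BoundedContinuousFunction.tendsto_iff_tendstoUniformly] at hf
    rw [Metric.tendstoUniformly_iff] at hf
    rw [Metric.tendstoUniformlyOn_iff]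
    intro ε hε
    filter_upwards [hf ε hε] with n hn z hz
    rw [extz_apply f ⟨z, hz⟩, extz_apply (u n) ⟨z, hz⟩]
    exact hn ⟨z, hz⟩
  exact this.tendstoLocallyUniformlyOn.differentiableOn (Eventually.of_forall hu)
    Metric.isOpen_ball

/-- The Banach algebra of bounded holomorphic functions on the unit disc. -/
def HB : Type := ↥Hinf

noncomputable instance : NormedCommRing HB := inferInstanceAs (NormedCommRing ↥Hinf)

noncomputable instance : NormedAlgebra ℝ HB := inferInstanceAs (NormedAlgebra ℝ ↥Hinf)

instance : Nonempty Dk := ⟨⟨0, by simp⟩⟩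

instance : NormOneClass HB := ⟨(norm_one : ‖(1 : BoundedContinuousFunction Dk ℂ)‖ = 1)⟩

instance : CompleteSpace HB := Hinf_closed.completeSpace_coe

/-- Evaluation character. -/
noncomputable def evH (z : Dk) : HB →ₐ[ℝ] ℂ where
  toFun f := f.1 z
  map_one' := rfl
  map_mul' _ _ := rfl
  map_zero' := rfl
  map_add' _ _ := rfl
  commutes' _ := rfl

lemma evH_le (z : Dk) (x : HB) : ‖evH z x‖ ≤ ‖x‖ := x.1.norm_coe_le_norm z

lemma evH_cont (z : Dk) : Continuous (evH z) :=
  AddMonoidHomClass.continuous_of_bound (evH z) 1 (fun x => by rw [one_mul]; exact evH_le z x)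

lemma HB_ext {x y : HB} (h : ∀ z, evH z x = evH z y) : x = y := by
  apply Subtype.ext
  ext z
  exact h z

lemma HB_diff (x : HB) : DifferentiableOn ℂ (extz x.1) (Metric.ball (0 : ℂ) 1) := x.2

lemma evH_eq_extz (x : HB) (z : Dk) : evH z x = extz x.1 z := (extz_apply _ z).symm

lemma mkH (G : ℂ → ℂ) (hG : DifferentiableOn ℂ G (Metric.ball (0 : ℂ) 1)) (c : ℝ)
    (hc : ∀ z ∈ Metric.ball (0 : ℂ) 1, ‖G z‖ ≤ c) :
    ∃ x : HB, (∀ z, evH z x = G z) ∧ ∀ C, 0 ≤ C → (∀ z ∈ Metric.ball (0 : ℂ) 1, ‖G z‖ ≤ C) → ‖x‖ ≤ C := by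
  have hcont : Continuous (fun z : Dk => G z) := hG.continuousOn.domRestrict
  set f : BoundedContinuousFunction Dk ℂ :=
    BoundedContinuousFunction.ofNormedAddCommGroup (fun z : Dk => G z) hcont c
      (fun z => hc z z.2) with hf
  refine ⟨⟨f, hG.congr (extz_congr _ _ fun z => rfl)⟩, fun z => rfl, fun C hC h => ?_⟩
  exact (BoundedContinuousFunction.norm_le hC).2 fun z => h z z.2

lemma exists_SH : ∃ x : HB, (∀ z : Dk, evH z x = z) ∧ ‖x‖ ≤ 1 := by
  obtain ⟨x, h1, h2⟩ := mkH (fun z => z) differentiableOn_id 1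
    (fun z hz => by simpa using (mem_ball_zero_iff.1 hz).le)
  exact ⟨x, h1, h2 1 zero_le_one (fun z hz => by simpa using (mem_ball_zero_iff.1 hz).le)⟩

/-- The coordinate function. -/
noncomputable def SH : HB := exists_SH.choose
lemma evH_SH (z : Dk) : evH z SH = z := exists_SH.choose_spec.1 z
lemma norm_SH : ‖SH‖ ≤ 1 := exists_SH.choose_spec.2

lemma exists_IH : ∃ x : HB, ∀ z : Dk, evH z x = Complex.I := by
  obtain ⟨x, h1, h2⟩ := mkH (fun _ => Complex.I) (differentiableOn_const _) 1 (fun z hz => by simp)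
  exact ⟨x, h1⟩

/-- The constant functions. -/
noncomputable def KH : ℂ →L[ℝ] HB :=
  Complex.reCLM.smulRight (1 : HB) + Complex.imCLM.smulRight exists_IH.choose

lemma evH_KH (z : Dk) (c : ℂ) : evH z (KH c) = c := by
  have := exists_IH.choose_spec z
  simp only [KH, add_apply, ContinuousLinearMap.smulRight_apply, map_add,
    map_smul, this, map_one]
  simp [Complex.re_add_im]

/-- The origin of the disc. -/
def oD : Dk := ⟨0, by simp⟩

lemma div_step (x : HB) : ∃ (c : ℂ) (y : HB), x = KH c + SH * y := by
  have h0 : Metric.ball (0 : ℂ) 1 ∈ 𝓝 (0 : ℂ) := Metric.ball_mem_nhds _ one_pos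
  set G := dslope (extz x.1) 0 with hG
  have hd : DifferentiableOn ℂ G (Metric.ball (0 : ℂ) 1) :=
    (Complex.differentiableOn_dslope h0).2 (HB_diff x)
  have hcb : ContinuousOn G (Metric.closedBall (0 : ℂ) (1/2)) :=
    hd.continuousOn.mono (Metric.closedBall_subset_ball (by norm_num))
  obtain ⟨C, hC⟩ := (isCompact_closedBall (0 : ℂ) (1/2)).exists_bound_of_continuousOn hcb
  have hbd : ∀ z ∈ Metric.ball (0 : ℂ) 1, ‖G z‖ ≤ max C (4 * ‖x‖) := by
    intro z hz
    by_cases hz2 : z ∈ Metric.closedBall (0 : ℂ) (1/2)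
    · exact (hC z hz2).trans (le_max_left _ _)
    · apply le_max_of_le_right
      have hz3 : 1/2 < ‖z‖ := by simpa using hz2
      have hz0 : z ≠ 0 := by rintro rfl; norm_num at hz3
      have e1 : ‖extz x.1 z‖ ≤ ‖x‖ := by
        have := evH_le ⟨z, hz⟩ x
        rwa [evH_eq_extz] at this
      have e2 : ‖extz x.1 0‖ ≤ ‖x‖ := by
        have := evH_le oD x
        rwa [evH_eq_extz] at this
      rw [hG, dslope_of_ne _ hz0, slope_def_field, norm_div, sub_zero,
        div_le_iff₀ (by linarith)]
      have := norm_sub_le (extz x.1 z) (extz x.1 0)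
      nlinarith [norm_nonneg x]
  obtain ⟨y, hy, -⟩ := mkH G hd _ hbd
  refine ⟨evH oD x, y, HB_ext fun z => ?_⟩
  rw [map_add, map_mul, evH_KH, evH_SH, hy, evH_eq_extz, evH_eq_extz]
  have := sub_smul_dslope (extz x.1) 0 (z : ℂ)
  simp only [sub_zero, smul_eq_mul] at this
  rw [hG, this]
  simp [oD]

lemma SH_cancel (y : HB) (h : SH * y = 0) : y = 0 := by
  have hz : ∀ z : Dk, (z : ℂ) ≠ 0 → evH z y = 0 := by
    intro z hz
    have := congrArg (evH z) h
    rw [map_mul, evH_SH, map_zero] at this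
    exact (mul_eq_zero.1 this).resolve_left hz
  refine HB_ext fun z => ?_
  rw [map_zero]
  by_cases h0 : (z : ℂ) = 0
  · have hc : ContinuousAt (extz y.1) 0 :=
      ((HB_diff y).differentiableAt (Metric.ball_mem_nhds _ one_pos)).continuousAt
    have ht : Tendsto (extz y.1) (𝓝[≠] 0) (𝓝 0) := by
      refine tendsto_const_nhds.congr' ?_
      filter_upwards [self_mem_nhdsWithin,
        mem_nhdsWithin_of_mem_nhds (Metric.ball_mem_nhds (0 : ℂ) one_pos)] with w hw hw1
      have := hz ⟨w, hw1⟩ hw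
      rw [evH_eq_extz] at this
      exact this.symm
    have := tendsto_nhds_unique (hc.tendsto.mono_left nhdsWithin_le_nhds) ht
    rw [evH_eq_extz, h0, this]
  · exact hz z h0

lemma div_exists (b : ℕ) (x : HB) : ∃ (y : HB) (r : Fin b → ℂ),
    x = y * SH ^ b + ∑ j, KH (r j) * SH ^ (j : ℕ) := by
  induction b with
  | zero => exact ⟨x, fun _ => 0, by simp⟩
  | succ b ih =>
    obtain ⟨y, r, h⟩ := ih
    obtain ⟨c, y', hy⟩ := div_step y
    refine ⟨y', Fin.snoc r c, ?_⟩
    rw [Fin.sum_univ_castSucc]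
    simp only [Fin.snoc_castSucc, Fin.snoc_last, Fin.val_castSucc, Fin.val_last]
    rw [h, hy]; ring

lemma div_unique (b : ℕ) (y : HB) (r : Fin b → ℂ)
    (h : y * SH ^ b + ∑ j, KH (r j) * SH ^ (j : ℕ) = 0) : y = 0 ∧ r = 0 := by
  induction b with
  | zero => exact ⟨by simpa using h, Subsingleton.elim _ _⟩
  | succ b ih =>
    rw [Fin.sum_univ_succ] at h
    simp only [Fin.val_zero, pow_zero, mul_one, Fin.val_succ] at h
    have hr0 : r 0 = 0 := by
      have := congrArg (evH oD) h
      simpa [evH_SH, evH_KH, oD] using this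
    rw [hr0, map_zero, zero_add] at h
    obtain ⟨h1, h2⟩ := ih (fun j => r j.succ) (by
      apply SH_cancel
      rw [← h, mul_add, Finset.mul_sum]
      congr 1
      · ring
      · exact Finset.sum_congr rfl fun j _ => by ring)
    refine ⟨h1, ?_⟩
    ext j
    refine Fin.cases hr0 (fun i => ?_) j
    exact congrFun h2 i

/-- The polynomial part of the division operator. -/
noncomputable def polyPart (b : ℕ) : (Fin b → ℂ) →L[ℝ] HB :=
  ∑ j : Fin b, ((ContinuousLinearMap.mul ℝ HB).flip (SH ^ (j : ℕ))).comp
    (KH.comp (ContinuousLinearMap.proj (R := ℝ) (φ := fun _ : Fin b => ℂ) j))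

lemma polyPart_apply (b : ℕ) (r : Fin b → ℂ) : polyPart b r = ∑ j, KH (r j) * SH ^ (j : ℕ) := by
  simp [polyPart, mul_comm]

/-- The division operator. -/
noncomputable def divOp (b : ℕ) (f : HB) : (HB × (Fin b → ℂ)) →L[ℝ] HB :=
  ((ContinuousLinearMap.mul ℝ HB).flip f).comp (ContinuousLinearMap.fst ℝ HB (Fin b → ℂ)) +
    (polyPart b).comp (ContinuousLinearMap.snd ℝ HB (Fin b → ℂ))

lemma divOp_apply (b : ℕ) (f : HB) (x : HB × (Fin b → ℂ)) :
    divOp b f x = x.1 * f + ∑ j, KH (x.2 j) * SH ^ (j : ℕ) := by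
  simp [divOp, polyPart_apply, mul_comm]

lemma core {E : Type*} [NormedAddCommGroup E] [NormedSpace ℝ E] (b : ℕ) (Ff G : E → HB)
    (hF : AnalyticAt ℝ Ff 0) (hG : AnalyticAt ℝ G 0) (w : HBˣ) (hF0 : Ff 0 = SH ^ b * w) :
    ∃ sol : E → HB × (Fin b → ℂ), AnalyticAt ℝ sol 0 ∧
      (∀ᶠ y in 𝓝 0, G y = (sol y).1 * Ff y + ∑ j, KH ((sol y).2 j) * SH ^ (j : ℕ)) ∧
      ∀ (q : HB) (r : Fin b → ℂ), G 0 = q * Ff 0 + ∑ j, KH (r j) * SH ^ (j : ℕ) → sol 0 = (q, r) := by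
  have hinj : Function.Injective (divOp b (Ff 0)) := by
    rw [injective_iff_map_eq_zero]
    intro x hx
    rw [divOp_apply, hF0] at hx
    obtain ⟨h1, h2⟩ := div_unique b (x.1 * w) x.2 (by rw [← hx]; ring)
    have : x.1 = 0 := by simpa using h1
    exact Prod.ext this h2
  have hsurj : Function.Surjective (divOp b (Ff 0)) := by
    intro x
    obtain ⟨y, r, h⟩ := div_exists b x
    refine ⟨(y * (w⁻¹ : HBˣ), r), ?_⟩
    rw [divOp_apply, hF0, h]
    congr 1
    have : (w⁻¹ : HBˣ) * (w : HB) = 1 := by simp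
    calc y * (w⁻¹ : HBˣ) * (SH ^ b * w) = y * SH ^ b * ((w⁻¹ : HBˣ) * (w : HB)) := by ring
      _ = _ := by rw [this, mul_one]
  set e : (HB × (Fin b → ℂ)) ≃L[ℝ] HB := ContinuousLinearEquiv.ofBijective (divOp b (Ff 0))
    (LinearMap.ker_eq_bot.2 hinj) (LinearMap.range_eq_top.2 hsurj) with he
  have hecoe : ∀ x, e x = divOp b (Ff 0) x := fun x => rfl
  set T : E → (HB × (Fin b → ℂ)) →L[ℝ] (HB × (Fin b → ℂ)) :=
    fun y => (e.symm : HB →L[ℝ] (HB × (Fin b → ℂ))).comp (divOp b (Ff y)) with hT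
  have hdivan : AnalyticAt ℝ (fun y => divOp b (Ff y)) 0 := by
    have h1 : AnalyticAt ℝ (fun y => (((ContinuousLinearMap.compL ℝ (HB × (Fin b → ℂ)) HB HB).flip
      (ContinuousLinearMap.fst ℝ HB (Fin b → ℂ))).comp (ContinuousLinearMap.mul ℝ HB).flip) (Ff y)) 0 :=
      (ContinuousLinearMap.analyticAt _ _).comp hF
    exact h1.add analyticAt_const
  have hTan : AnalyticAt ℝ T 0 :=
    (ContinuousLinearMap.analyticAt (ContinuousLinearMap.compL ℝ (HB × (Fin b → ℂ)) HB
      (HB × (Fin b → ℂ)) (e.symm : HB →L[ℝ] (HB × (Fin b → ℂ)))) _).comp hdivan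
  have hT0 : T 0 = 1 := by
    refine ContinuousLinearMap.ext fun x => ?_
    show e.symm (divOp b (Ff 0) x) = x
    rw [← hecoe]; simp
  have hinvan : AnalyticAt ℝ (fun y => Ring.inverse (T y)) 0 := by
    have := analyticAt_inverse (𝕜 := ℝ) (A := (HB × (Fin b → ℂ)) →L[ℝ] (HB × (Fin b → ℂ))) 1
    rw [Units.val_one] at this
    exact AnalyticAt.fun_comp (by rw [hT0]; exact this) hTan
  refine ⟨fun y => Ring.inverse (T y) (e.symm (G y)), ?_, ?_, ?_⟩
  · exact ((ContinuousLinearMap.id ℝ ((HB × (Fin b → ℂ)) →L[ℝ] (HB × (Fin b → ℂ)))).analyticAt_bilinear _).comp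
      (hinvan.prod (((e.symm : HB →L[ℝ] (HB × (Fin b → ℂ))).analyticAt _).comp hG))
  · have hu : ∀ᶠ y in 𝓝 (0 : E), IsUnit (T y) := by
      have h1 : ∀ᶠ A in 𝓝 (T 0), IsUnit A := by
        rw [hT0]
        have := Units.nhds (R := (HB × (Fin b → ℂ)) →L[ℝ] (HB × (Fin b → ℂ))) 1
        rw [Units.val_one] at this
        exact this
      exact hTan.continuousAt.eventually h1
    filter_upwards [hu] with y hy
    have h1 : T y (Ring.inverse (T y) (e.symm (G y))) = e.symm (G y) := by
      have := Ring.mul_inverse_cancel (T y) hy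
      have h2 := congrArg (fun A => A (e.symm (G y))) this
      simpa using h2
    have h2 : e.symm (divOp b (Ff y) (Ring.inverse (T y) (e.symm (G y)))) = e.symm (G y) := h1
    have h3 := e.symm.injective h2
    rw [divOp_apply] at h3
    exact h3.symm
  · intro q r h
    have : G 0 = e (q, r) := by rw [hecoe, divOp_apply]; exact h
    show Ring.inverse (T 0) (e.symm (G 0)) = (q, r)
    rw [this, hT0]; simp

lemma lift_lemma (n : ℕ) (g : (Fin n → ℝ) × ℝ → ℝ) (hg : AnalyticAt ℝ g 0) :
    ∃ ε : ℝ, 0 < ε ∧ ∃ H : ℂ → ℂ, DifferentiableOn ℂ H (Metric.ball 0 ε) ∧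
      (∀ t : ℝ, |t| < ε → H t = (g (0, t) : ℂ)) ∧
      ∀ ρ : ℝ, 0 < ρ → ρ < ε → ∃ G : (Fin n → ℝ) → HB, AnalyticAt ℝ G 0 ∧
        (∀ᶠ y in 𝓝 0, ∀ (z : Dk) (t : ℝ), (z : ℂ) = t → evH z (G y) = (g (y, ρ * t) : ℂ)) ∧
        ∀ z : Dk, evH z (G 0) = H (ρ * z) := by
  set L : (Option (Fin n) → ℝ) → (Fin n → ℝ) × ℝ := fun x => (fun i => x (some i), x none) with hL
  have hLan : AnalyticAt ℝ L 0 := by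
    refine AnalyticAt.prod ?_ ?_
    · exact (ContinuousLinearMap.pi fun i : Fin n =>
        ContinuousLinearMap.proj (R := ℝ) (φ := fun _ : Option (Fin n) => ℝ) (some i)).analyticAt _
    · exact (ContinuousLinearMap.proj (R := ℝ) (φ := fun _ : Option (Fin n) => ℝ) none).analyticAt _
  have hgL : AnalyticAt ℝ (fun x => g (L x)) 0 := AnalyticAt.fun_comp (f := L) (by exact hg) hLan
  obtain ⟨p, r1, hp⟩ := hgL
  obtain ⟨r, hr, hrad⟩ := extS_radius p (hp.r_pos.trans_le hp.r_le)
  obtain ⟨s, hs0, hs⟩ := ENNReal.lt_iff_exists_nnreal_btwn.1 hp.r_pos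
  have hs0' : 0 < s := by exact_mod_cast hs0
  set ε0 : ℝ := min r s with hε0
  have hε0pos : 0 < ε0 := lt_min hr hs0'
  have key : ∀ (B : Type) [NormedCommRing B] [NormedAlgebra ℝ B] [NormOneClass B]
      (b : Option (Fin n) → B), ‖b‖ < ε0 → b ∈ Metric.eball (0 : Option (Fin n) → B) (extS p B).radius := by
    intro B _ _ _ b hb
    refine Metric.eball_subset_eball (hrad B) ?_
    rw [Metric.eball_coe, mem_ball_zero_iff]
    exact hb.trans_le (min_le_left _ _)
  have key2 : ∀ x : Option (Fin n) → ℝ, ‖x‖ < ε0 → p.sum x = g (L x) := by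
    intro x hx
    have : x ∈ Metric.eball (0 : Option (Fin n) → ℝ) r1 := by
      refine Metric.eball_subset_eball hs.le ?_
      rw [Metric.eball_coe, mem_ball_zero_iff]
      exact hx.trans_le (min_le_right _ _)
    have := hp.sum this
    rw [zero_add] at this
    exact this.symm
  have key3 : ∀ x : Option (Fin n) → ℝ, ‖x‖ < ε0 →
      (extS p ℂ).sum (fun i => (x i : ℂ)) = (g (L x) : ℂ) := by
    intro x hx
    have := extS_map p ℝ ℂ Complex.ofRealAm Complex.continuous_ofReal x (key ℝ x hx)
    rw [extS_real, key2 x hx] at this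
    exact this.symm
  set bv : ℝ → (Fin n → ℝ) → Option (Fin n) → HB :=
    fun ρ y o => o.elim (ρ • SH) (fun i => y i • 1) with hbv
  have hbvn : ∀ ρ y, 0 < ρ → ρ < ε0 → ‖y‖ < ε0 → ‖bv ρ y‖ < ε0 := by
    intro ρ y hρ hρε hy
    rw [pi_norm_lt_iff hε0pos]
    rintro (_ | i)
    · show ‖ρ • SH‖ < ε0
      rw [norm_smul, Real.norm_of_nonneg hρ.le]
      have := norm_SH
      nlinarith [norm_nonneg SH]
    · show ‖y i • (1 : HB)‖ < ε0
      rw [norm_smul, norm_one, mul_one]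
      exact (norm_le_pi_norm y i).trans_lt hy
  set H : ℂ → ℂ := fun w => (extS p ℂ).sum (fun o => o.elim w (fun _ => 0)) with hH
  have hev0 : ∀ ρ, 0 < ρ → ρ < ε0 → ∀ z : Dk, evH z ((extS p HB).sum (bv ρ 0)) = H (ρ * z) := by
    intro ρ h1 h2 z
    rw [extS_map p HB ℂ (evH z) (evH_cont z) _ (key HB _ (hbvn ρ 0 h1 h2 (by simpa using hε0pos)))]
    simp only [hH]
    congr 1
    ext1 o
    rcases o with _ | i
    · simp [hbv, evH_SH]
    · simp [hbv]
  refine ⟨ε0 / 2, by positivity, H, ?_, ?_, ?_⟩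
  · have h1 : 0 < ε0 / 2 := by positivity
    have h2 := hev0 (ε0 / 2) h1 (by linarith)
    set x := (extS p HB).sum (bv (ε0 / 2) 0)
    have h3 : DifferentiableOn ℂ (fun w : ℂ => extz x.1 (w / (ε0 / 2 : ℝ))) (Metric.ball 0 (ε0 / 2)) := by
      refine (HB_diff x).comp (differentiableOn_id.div_const _) ?_
      intro w hw
      rw [mem_ball_zero_iff] at hw ⊢
      simp only [norm_div, Complex.norm_real, Real.norm_of_nonneg h1.le]
      rwa [div_lt_one h1]
    refine h3.congr ?_
    intro w hw
    have hw' : w / (ε0 / 2 : ℝ) ∈ Metric.ball (0 : ℂ) 1 := by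
      rw [mem_ball_zero_iff] at hw ⊢
      simp only [norm_div, Complex.norm_real, Real.norm_of_nonneg h1.le]
      rwa [div_lt_one h1]
    have h4 := h2 ⟨_, hw'⟩
    rw [evH_eq_extz] at h4
    simp only at h4
    rw [h4]
    congr 1
    have : ((ε0 / 2 : ℝ) : ℂ) ≠ 0 := by exact_mod_cast h1.ne'
    field_simp
  · intro t ht
    have := key3 (fun o => o.elim t (fun _ => 0)) (by
      rw [pi_norm_lt_iff hε0pos]
      rintro (_ | i)
      · simp only [Option.elim, Real.norm_eq_abs]; linarith
      · simpa using hε0pos)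
    have e : (fun i : Fin n => (0 : ℝ)) = 0 := rfl
    simp only [hL, Option.elim, e] at this
    rw [← this]
    simp only [hH]
    congr 1
    ext1 o
    rcases o with _ | i <;> simp
  · intro ρ hρ hρε
    have hρ' : ρ < ε0 := by linarith
    refine ⟨fun y => (extS p HB).sum (bv ρ y), ?_, ?_, hev0 ρ hρ hρ'⟩
    · have hmem := key HB _ (hbvn ρ 0 hρ hρ' (by simpa using hε0pos))
      have hpos : 0 < (extS p HB).radius := lt_of_lt_of_le (by exact_mod_cast hr) (hrad HB)
      have h1 : AnalyticAt ℝ (extS p HB).sum (bv ρ 0) :=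
        ((extS p HB).hasFPowerSeriesOnBall hpos).analyticOnNhd _ hmem
      refine AnalyticAt.fun_comp (f := bv ρ) h1 ?_
      rw [analyticAt_pi_iff]
      rintro (_ | i)
      · exact analyticAt_const
      · exact ((ContinuousLinearMap.proj (R := ℝ) (φ := fun _ : Fin n => ℝ) i).analyticAt _).smul
          analyticAt_const
    · filter_upwards [Metric.ball_mem_nhds (0 : Fin n → ℝ) hε0pos] with y hy z t hzt
      rw [mem_ball_zero_iff] at hy
      rw [extS_map p HB ℂ (evH z) (evH_cont z) _ (key HB _ (hbvn ρ y hρ hρ' hy))]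
      have ht : |t| < 1 := by
        have := mem_ball_zero_iff.1 z.2
        rw [hzt, Complex.norm_real] at this
        exact this
      have := key3 (fun o => o.elim (ρ * t) y) (by
        rw [pi_norm_lt_iff hε0pos]
        rintro (_ | i)
        · simp only [Option.elim, Real.norm_eq_abs, abs_mul, abs_of_pos hρ]
          nlinarith [abs_nonneg t]
        · exact (norm_le_pi_norm y i).trans_lt hy)
      simp only [hL, Option.elim] at this
      rw [← this]
      congr 1
      ext1 o
      rcases o with _ | i <;> simp [hbv, evH_SH, hzt]

lemma unit_lemma (H : ℂ → ℂ) (ε : ℝ) (hε : 0 < ε) (hH : DifferentiableOn ℂ H (Metric.ball 0 ε))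
    (hne : ¬ ∀ᶠ z in 𝓝 (0 : ℂ), H z = 0) :
    ∃ (b : ℕ) (ρ₀ : ℝ), 0 < ρ₀ ∧ ∀ ρ : ℝ, 0 < ρ → ρ < ρ₀ → ∃ w : HBˣ,
      ∀ z : Dk, H (ρ * z) = (z : ℂ) ^ b * evH z w := by
  have hHa : AnalyticAt ℂ H 0 := hH.analyticAt (Metric.ball_mem_nhds _ hε)
  obtain ⟨b, u, hu, hu0, hub⟩ := hHa.exists_eventuallyEq_pow_smul_nonzero_iff.2 hne
  have h1 : ∀ᶠ z in 𝓝 (0 : ℂ), ‖u z‖ < ‖u 0‖ + 1 :=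
    hu.continuousAt.norm.eventually_lt continuousAt_const (by simp)
  have h2 : ∀ᶠ z in 𝓝 (0 : ℂ), ‖u 0‖ / 2 < ‖u z‖ :=
    continuousAt_const.eventually_lt hu.continuousAt.norm (by simpa using hu0)
  obtain ⟨ρ₀, hρ₀, hball⟩ := Metric.eventually_nhds_iff_ball.1
    ((h1.and h2).and (hu.eventually_analyticAt.and hub))
  refine ⟨b, ρ₀, hρ₀, fun ρ hρ hρ' => ?_⟩
  have hm : ∀ z ∈ Metric.ball (0 : ℂ) 1, (ρ : ℂ) * z ∈ Metric.ball (0 : ℂ) ρ₀ := by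
    intro z hz
    rw [mem_ball_zero_iff] at hz ⊢
    rw [norm_mul, Complex.norm_real, Real.norm_of_nonneg hρ.le]
    nlinarith [norm_nonneg z]
  have hun : ∀ z ∈ Metric.ball (0 : ℂ) 1, u (ρ * z) ≠ 0 := by
    intro z hz h
    have := (hball _ (hm z hz)).1.2
    rw [h, norm_zero] at this
    have := norm_nonneg (u 0)
    linarith
  have hρc : (ρ : ℂ) ≠ 0 := by exact_mod_cast hρ.ne'
  have hud : DifferentiableOn ℂ (fun z : ℂ => u (ρ * z)) (Metric.ball (0 : ℂ) 1) := by
    intro z hz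
    have hd := (hball _ (hm z hz)).2.1.differentiableAt
    exact (DifferentiableAt.fun_comp' z (g := u) (f := fun z : ℂ => ρ * z) hd
      (by fun_prop)).differentiableWithinAt
  obtain ⟨x, hx, -⟩ := mkH (fun z => (ρ : ℂ) ^ b * u (ρ * z)) (hud.const_mul _)
    (ρ ^ b * (‖u 0‖ + 1)) (by
      intro z hz
      rw [norm_mul, norm_pow, Complex.norm_real, Real.norm_of_nonneg hρ.le]
      have := (hball _ (hm z hz)).1.1
      gcongr)
  obtain ⟨x', hx', -⟩ := mkH (fun z => ((ρ : ℂ) ^ b * u (ρ * z))⁻¹)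
    ((hud.const_mul _).inv fun z hz => mul_ne_zero (pow_ne_zero _ hρc) (hun z hz))
    ((ρ ^ b * (‖u 0‖ / 2))⁻¹) (by
      intro z hz
      rw [norm_inv, norm_mul, norm_pow, Complex.norm_real, Real.norm_of_nonneg hρ.le]
      have := (hball _ (hm z hz)).1.2
      have : 0 < ‖u 0‖ := norm_pos_iff.2 hu0
      gcongr)
  have hxx : x * x' = 1 := by
    refine HB_ext fun z => ?_
    rw [map_mul, hx, hx', map_one]
    exact mul_inv_cancel₀ (mul_ne_zero (pow_ne_zero _ hρc) (hun z z.2))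
  refine ⟨⟨x, x', hxx, by rw [mul_comm, hxx]⟩, fun z => ?_⟩
  show _ = (z : ℂ) ^ b * evH z x
  rw [hx, (hball _ (hm z z.2)).2.2, sub_zero, smul_eq_mul]
  ring

lemma prep_lemma (n : ℕ) (f : (Fin n → ℝ) × ℝ → ℝ) (hf : AnalyticAt ℝ f 0)
    (hne : ¬ ∀ᶠ t in 𝓝 (0 : ℝ), f (0, t) = 0) :
    ∃ (b : ℕ) (ρ₀ : ℝ), 0 < ρ₀ ∧ ∀ ρ : ℝ, 0 < ρ → ρ < ρ₀ →
      ∃ (F : (Fin n → ℝ) → HB) (w : HBˣ), AnalyticAt ℝ F 0 ∧ F 0 = SH ^ b * w ∧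
        ∀ᶠ y in 𝓝 0, ∀ (z : Dk) (t : ℝ), (z : ℂ) = t → evH z (F y) = (f (y, ρ * t) : ℂ) := by
  obtain ⟨ε, hε, H, hH, hHr, hlift⟩ := lift_lemma n f hf
  have hne' : ¬ ∀ᶠ z in 𝓝 (0 : ℂ), H z = 0 := by
    intro h
    apply hne
    have h1 : Tendsto (fun t : ℝ => (t : ℂ)) (𝓝 0) (𝓝 0) := by
      simpa using Complex.continuous_ofReal.tendsto 0
    filter_upwards [h1.eventually h, Metric.ball_mem_nhds (0 : ℝ) hε] with t ht1 ht2
    rw [hHr t (by simpa using ht2)] at ht1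
    exact_mod_cast ht1
  obtain ⟨b, ρ₀, hρ₀, hun⟩ := unit_lemma H ε hε hH hne'
  refine ⟨b, min ρ₀ ε, lt_min hρ₀ hε, fun ρ hρ hρ' => ?_⟩
  obtain ⟨w, hw⟩ := hun ρ hρ (hρ'.trans_le (min_le_left _ _))
  obtain ⟨G, hG, hG1, hG2⟩ := hlift ρ hρ (hρ'.trans_le (min_le_right _ _))
  refine ⟨G, w, hG, HB_ext fun z => ?_, hG1⟩
  rw [hG2, hw, map_mul, map_pow, evH_SH]

lemma extz_contAt (x : HB) : ContinuousAt (extz x.1) 0 :=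
  ((HB_diff x).differentiableAt (Metric.ball_mem_nhds _ one_pos)).continuousAt

lemma mem_disc_of_lt {ρ t : ℝ} (hρ : 0 < ρ) (ht : |t| < ρ) :
    ((t / ρ : ℝ) : ℂ) ∈ Metric.ball (0 : ℂ) 1 := by
  rw [mem_ball_zero_iff, Complex.norm_real, Real.norm_eq_abs, abs_div, abs_of_pos hρ]
  rwa [div_lt_one hρ]

lemma reCoord_analytic {n b : ℕ} (sol : (Fin n → ℝ) → HB × (Fin b → ℂ)) (h : AnalyticAt ℝ sol 0)
    (j : Fin b) (c : ℝ) : AnalyticAt ℝ (fun y => c * ((sol y).2 j).re) 0 := by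
  have h1 : AnalyticAt ℝ (fun y => (Complex.reCLM.comp
    ((ContinuousLinearMap.proj (R := ℝ) (φ := fun _ : Fin b => ℂ) j).comp
      (ContinuousLinearMap.snd ℝ HB (Fin b → ℂ)))) (sol y)) 0 :=
    (ContinuousLinearMap.analyticAt _ _).comp h
  exact analyticAt_const.mul h1

theorem weier (n : ℕ) (f : (Fin n → ℝ) × ℝ → ℝ) (hf : AnalyticAt ℝ f 0)
    (hne : ¬ ∀ᶠ t in 𝓝 (0 : ℝ), f (0, t) = 0) :
    ∃ (b : ℕ) (a : Fin b → (Fin n → ℝ) → ℝ), (∀ j, AnalyticAt ℝ (a j) 0) ∧ (∀ j, a j 0 = 0) ∧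
      (∀ᶠ x in 𝓝 (0 : (Fin n → ℝ) × ℝ),
        (f x = 0 ↔ x.2 ^ b + ∑ j, a j x.1 * x.2 ^ (j : ℕ) = 0)) ∧
      ∀ g : (Fin n → ℝ) × ℝ → ℝ, AnalyticAt ℝ g 0 → ∃ r : Fin b → (Fin n → ℝ) → ℝ,
        (∀ j, AnalyticAt ℝ (r j) 0) ∧ ∀ᶠ x in 𝓝 (0 : (Fin n → ℝ) × ℝ),
          f x = 0 → g x = ∑ j, r j x.1 * x.2 ^ (j : ℕ) := by
  obtain ⟨b, ρ₀, hρ₀, hprep⟩ := prep_lemma n f hf hne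
  have hfst : Tendsto (Prod.fst : (Fin n → ℝ) × ℝ → (Fin n → ℝ)) (𝓝 0) (𝓝 0) :=
    continuous_fst.tendsto (0 : (Fin n → ℝ) × ℝ)
  have hsnd : Tendsto (Prod.snd : (Fin n → ℝ) × ℝ → ℝ) (𝓝 0) (𝓝 0) :=
    continuous_snd.tendsto (0 : (Fin n → ℝ) × ℝ)
  have main : ∀ (G : (Fin n → ℝ) → HB) (F : (Fin n → ℝ) → HB) (g : (Fin n → ℝ) × ℝ → ℝ) (ρ : ℝ),
      0 < ρ → (∀ᶠ y in 𝓝 0, ∀ (z : Dk) (t : ℝ), (z : ℂ) = t → evH z (F y) = (f (y, ρ * t) : ℂ)) →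
      (∀ᶠ y in 𝓝 0, ∀ (z : Dk) (t : ℝ), (z : ℂ) = t → evH z (G y) = (g (y, ρ * t) : ℂ)) →
      ∀ sol : (Fin n → ℝ) → HB × (Fin b → ℂ),
      (∀ᶠ y in 𝓝 0, G y = (sol y).1 * F y + ∑ j, KH ((sol y).2 j) * SH ^ (j : ℕ)) →
      ∀ᶠ x in 𝓝 (0 : (Fin n → ℝ) × ℝ), ∃ hz : ((x.2 / ρ : ℝ) : ℂ) ∈ Metric.ball (0 : ℂ) 1,
        g x = (evH ⟨_, hz⟩ (sol x.1).1).re * f x + ∑ j, ((sol x.1).2 j).re * (x.2 / ρ) ^ (j : ℕ) := by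
    intro G F g ρ hρ hF hG sol hsol
    filter_upwards [hfst.eventually hF, hfst.eventually hG, hfst.eventually hsol,
      hsnd.eventually (Metric.ball_mem_nhds (0 : ℝ) hρ)] with x h1 h2 h3 h4
    have hx2 : |x.2| < ρ := by simpa using h4
    have hz := mem_disc_of_lt hρ hx2
    refine ⟨hz, ?_⟩
    have e1 := h1 ⟨_, hz⟩ (x.2 / ρ) rfl
    have e2 := h2 ⟨_, hz⟩ (x.2 / ρ) rfl
    rw [mul_div_cancel₀ _ hρ.ne'] at e1 e2
    have e3 := congrArg (evH ⟨_, hz⟩) h3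
    rw [map_add, map_mul, map_sum, e1, e2] at e3
    simp only [map_mul, map_pow, evH_KH, evH_SH] at e3
    have e4 := congrArg Complex.re e3
    rw [Complex.add_re, Complex.re_sum, Complex.ofReal_re, Complex.re_mul_ofReal] at e4
    rw [e4]
    congr 1
    refine Finset.sum_congr rfl fun j _ => ?_
    rw [← Complex.ofReal_pow, Complex.re_mul_ofReal]
  obtain ⟨ρ, hρh, hρlt⟩ : ∃ ρ : ℝ, 0 < ρ ∧ ρ < ρ₀ := ⟨ρ₀ / 2, by positivity, by linarith⟩
  obtain ⟨F, w, hF, hF0, hFe⟩ := hprep ρ hρh hρlt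
  obtain ⟨sol, hsol, hsole, hsol0⟩ := core b F (fun _ => SH ^ b) hF analyticAt_const w hF0
  have hs0 : sol 0 = (((w⁻¹ : HBˣ) : HB), 0) := by
    apply hsol0
    rw [hF0]
    have : ((w⁻¹ : HBˣ) : HB) * (w : HB) = 1 := by simp
    calc SH ^ b = SH ^ b * (((w⁻¹ : HBˣ) : HB) * (w : HB)) := by rw [this, mul_one]
      _ = _ := by simp only [Pi.zero_apply, map_zero, zero_mul, Finset.sum_const_zero, add_zero]; ring
  have hm := main (fun _ => SH ^ b) F (fun x => (x.2 / ρ) ^ b) ρ hρh hFe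
    (Eventually.of_forall fun y z t hzt => by
      rw [map_pow, evH_SH, hzt, mul_div_cancel_left₀ _ hρh.ne']; push_cast; rfl) sol hsole
  -- the value of `w⁻¹` at the origin is real and nonzero
  have hwim : (evH oD (w : HB)).im = 0 := by
    have hc : ContinuousAt (fun s : ℝ => (extz (w : HB).1 s).im) 0 := by
      have h1 : ContinuousAt (fun s : ℝ => (s : ℂ)) 0 := Complex.continuous_ofReal.continuousAt
      have h2 : ContinuousAt (fun s : ℝ => extz (w : HB).1 s) 0 :=
        ContinuousAt.comp' (g := extz (w : HB).1) (by simpa using extz_contAt (w : HB)) h1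
      exact Complex.continuous_im.continuousAt.comp h2
    have ht : Tendsto (fun s : ℝ => (extz (w : HB).1 s).im) (𝓝[≠] 0) (𝓝 0) := by
      refine tendsto_const_nhds.congr' ?_
      filter_upwards [self_mem_nhdsWithin,
        mem_nhdsWithin_of_mem_nhds (Metric.ball_mem_nhds (0 : ℝ) one_pos)] with s hs hs1
      have hsz : (s : ℂ) ∈ Metric.ball (0 : ℂ) 1 := by
        rw [mem_ball_zero_iff] at hs1 ⊢
        rwa [Complex.norm_real]
      have e1 := hFe.self_of_nhds ⟨_, hsz⟩ s rfl
      rw [hF0, map_mul, map_pow, evH_SH] at e1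
      have e2 := evH_eq_extz (w : HB) ⟨_, hsz⟩
      simp only at e2 e1
      rw [← e2]
      have e3 := congrArg Complex.im e1
      rw [← Complex.ofReal_pow, Complex.im_ofReal_mul, Complex.ofReal_im] at e3
      exact ((mul_eq_zero.1 e3).resolve_left (pow_ne_zero _ hs)).symm
    have := tendsto_nhds_unique (hc.tendsto.mono_left nhdsWithin_le_nhds) ht
    rw [evH_eq_extz]
    simpa [oD] using this
  set q0 : HB := ((w⁻¹ : HBˣ) : HB) with hq0
  have hprod : evH oD q0 * evH oD (w : HB) = 1 := by
    rw [← map_mul]; simp [hq0]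
  set c : ℝ := (evH oD q0).re with hcdef
  have hc0 : c ≠ 0 := by
    intro h
    have := congrArg Complex.re hprod
    rw [Complex.mul_re, hwim, ← hcdef, h] at this
    simp at this
  have hqne : ∀ᶠ x in 𝓝 (0 : (Fin n → ℝ) × ℝ), ∀ hz : ((x.2 / ρ : ℝ) : ℂ) ∈ Metric.ball (0 : ℂ) 1,
      (evH ⟨_, hz⟩ (sol x.1).1).re ≠ 0 := by
    have hcp : 0 < |c| / 2 := by positivity
    have h1 : ∀ᶠ y in 𝓝 (0 : Fin n → ℝ), ‖(sol y).1 - q0‖ < |c| / 2 := by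
      have : ContinuousAt (fun y => ‖(sol y).1 - q0‖) 0 :=
        ((continuous_fst.continuousAt.comp hsol.continuousAt).sub continuousAt_const).norm
      refine this.eventually_lt continuousAt_const ?_
      rw [hs0]; simpa using hcp
    have h2 : ∀ᶠ t in 𝓝 (0 : ℝ), |(extz q0.1 ((t / ρ : ℝ) : ℂ)).re - c| < |c| / 2 := by
      have h1 : ContinuousAt (fun s : ℝ => ((s / ρ : ℝ) : ℂ)) 0 := by fun_prop
      have h2 : ContinuousAt (fun s : ℝ => extz q0.1 ((s / ρ : ℝ) : ℂ)) 0 :=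
        ContinuousAt.comp' (g := extz q0.1) (by simpa using extz_contAt q0) h1
      have h3 : ContinuousAt (fun s : ℝ => |(extz q0.1 ((s / ρ : ℝ) : ℂ)).re - c|) 0 :=
        ((Complex.continuous_re.continuousAt.comp h2).sub continuousAt_const).abs
      refine h3.eventually_lt continuousAt_const ?_
      have : (extz q0.1 0).re = c := by
        rw [hcdef, evH_eq_extz]; rfl
      simpa [this] using hcp
    filter_upwards [hfst.eventually h1, hsnd.eventually h2] with x hx1 hx2 hz h
    have e1 := evH_le ⟨_, hz⟩ ((sol x.1).1 - q0)
    rw [map_sub] at e1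
    have e2 := (Complex.abs_re_le_norm _).trans e1
    rw [Complex.sub_re, h, zero_sub, abs_neg, evH_eq_extz] at e2
    simp only at e2
    have e3 := abs_sub_abs_le_abs_sub c ((extz q0.1 ((x.2 / ρ : ℝ) : ℂ)).re)
    rw [abs_sub_comm] at e3
    linarith
  refine ⟨b, fun j y => (-(ρ ^ b / ρ ^ (j : ℕ))) * ((sol y).2 j).re,
    fun j => reCoord_analytic sol hsol j _, ?_, ?_, ?_⟩
  · intro j; simp [hs0]
  · filter_upwards [hm, hqne] with x hx1 hx2
    obtain ⟨hz, e⟩ := hx1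
    have e5 : x.2 ^ b + ∑ j : Fin b, (-(ρ ^ b / ρ ^ (j : ℕ))) * ((sol x.1).2 j).re * x.2 ^ (j : ℕ)
        = ρ ^ b * ((evH ⟨_, hz⟩ (sol x.1).1).re * f x) := by
      have e6 : (evH ⟨_, hz⟩ (sol x.1).1).re * f x =
        (x.2 / ρ) ^ b - ∑ j : Fin b, ((sol x.1).2 j).re * (x.2 / ρ) ^ (j : ℕ) := by
        rw [e]; ring
      rw [e6, mul_sub, div_pow, mul_div_cancel₀ _ (pow_ne_zero _ hρh.ne'), Finset.mul_sum,
        sub_eq_add_neg, ← Finset.sum_neg_distrib]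
      congr 1
      refine Finset.sum_congr rfl fun j _ => ?_
      rw [div_pow]; ring
    rw [e5]
    constructor
    · intro h; rw [h]; simp
    · intro h
      have h1 := (mul_eq_zero.1 h).resolve_left (pow_ne_zero _ hρh.ne')
      exact (mul_eq_zero.1 h1).resolve_left (hx2 hz)
  · intro g hg
    obtain ⟨ε, hε, H, hH, hHr, hlift⟩ := lift_lemma n g hg
    set σ := min ρ₀ ε / 2 with hσ
    have hmin : 0 < min ρ₀ ε := lt_min hρ₀ hε
    have hσ0 : 0 < σ := by positivity
    have hσ1 : σ < min ρ₀ ε := by linarith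
    obtain ⟨F', w', hF', hF0', hFe'⟩ := hprep σ hσ0 (hσ1.trans_le (min_le_left _ _))
    obtain ⟨G, hG, hG1, hG2⟩ := hlift σ hσ0 (hσ1.trans_le (min_le_right _ _))
    obtain ⟨sol', hsol', hsole', -⟩ := core b F' G hF' hG w' hF0'
    refine ⟨fun j y => (1 / σ ^ (j : ℕ)) * ((sol' y).2 j).re,
      fun j => reCoord_analytic sol' hsol' j _, ?_⟩
    filter_upwards [main G F' g σ hσ0 hFe' hG1 sol' hsole'] with x hx hfx
    obtain ⟨hz, e⟩ := hx
    rw [e, hfx, mul_zero, zero_add]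
    refine Finset.sum_congr rfl fun j _ => ?_
    rw [div_pow]; ring

lemma exists_frequently_of_not_countable {Y : Type*} [TopologicalSpace Y]
    [SecondCountableTopology Y] (S : Set Y) (hS : ¬ S.Countable) :
    ∃ x ∈ S, ∃ᶠ y in 𝓝[≠] x, y ∈ S := by
  by_contra hcon
  push Not at hcon
  apply hS
  have hd : DiscreteTopology S := by
    rw [discreteTopology_subtype_iff]
    intro x hx
    have h1 : ∀ᶠ y in 𝓝[≠] x, y ∉ S := hcon x hx
    rw [inf_principal_eq_bot]
    exact h1
  have : Countable S := TopologicalSpace.separableSpace_iff_countable.1 inferInstance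
  exact this.to_set

/-- Iterated derivatives in the second variable. -/
noncomputable def itd (Φ : ℝ × ℝ → ℝ) : ℕ → ℝ × ℝ → ℝ
  | 0 => Φ
  | k + 1 => fun x => fderiv ℝ (itd Φ k) x (0, 1)

lemma itd_analytic (Φ : ℝ × ℝ → ℝ) (S : Set (ℝ × ℝ)) (h : AnalyticOnNhd ℝ Φ S) (k : ℕ) :
    AnalyticOnNhd ℝ (itd Φ k) S := by
  induction k with
  | zero => exact h
  | succ k ih =>
    intro x hx
    exact ((ContinuousLinearMap.apply ℝ ℝ ((0, 1) : ℝ × ℝ)).analyticAt _).comp (ih x hx).fderiv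

lemma itd_iteratedDeriv (Φ : ℝ × ℝ → ℝ) (J : Set ℝ) (h : AnalyticOnNhd ℝ Φ (J ×ˢ univ)) (s : ℝ)
    (hs : s ∈ J) (k : ℕ) : iteratedDeriv k (fun t => Φ (s, t)) = fun t => itd Φ k (s, t) := by
  induction k with
  | zero => simp [itd]
  | succ k ih =>
    rw [iteratedDeriv_succ, ih]
    ext t
    have h1 : HasFDerivAt (itd Φ k) (fderiv ℝ (itd Φ k) (s, t)) (s, t) :=
      (itd_analytic Φ _ h k (s, t) ⟨hs, mem_univ _⟩).differentiableAt.hasFDerivAt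
    have h2 : HasDerivAt (fun t : ℝ => ((s, t) : ℝ × ℝ)) (0, 1) t :=
      (hasDerivAt_const t s).prodMk (hasDerivAt_id t)
    exact (h1.comp_hasDerivAt t h2).deriv

lemma itd_exists (Φ : ℝ × ℝ → ℝ) (J : Set ℝ) (h : AnalyticOnNhd ℝ Φ (J ×ˢ univ)) (s : ℝ)
    (hs : s ∈ J) (t : ℝ) (hne : ¬ ∀ᶠ t' in 𝓝 t, Φ (s, t') = 0) (h0 : Φ (s, t) = 0) :
    ∃ m, itd Φ m (s, t) = 0 ∧ itd Φ (m + 1) (s, t) ≠ 0 := by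
  by_contra hcon
  push Not at hcon
  have hall : ∀ m, itd Φ m (s, t) = 0 := by
    intro m
    induction m with
    | zero => exact h0
    | succ m ih => exact hcon m ih
  apply hne
  have han : AnalyticAt ℝ (fun t => Φ (s, t)) t := by
    have h1 : AnalyticAt ℝ (fun t : ℝ => ((s, t) : ℝ × ℝ)) t := analyticAt_const.prod analyticAt_id
    exact AnalyticAt.fun_comp (g := Φ) (h (s, t) ⟨hs, mem_univ _⟩) h1
  rw [← analyticOrderAt_eq_top]
  refine ENat.eq_top_iff_forall_ge.2 fun m => ?_
  rw [natCast_le_analyticOrderAt_iff_iteratedDeriv_eq_zero han]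
  intro i _
  rw [itd_iteratedDeriv Φ J h s hs i]
  exact hall i

lemma implicit_arc (F : ℝ × ℝ → ℝ) (s₀ t₀ : ℝ) (hF : AnalyticAt ℝ F (s₀, t₀)) (h0 : F (s₀, t₀) = 0)
    (h1 : fderiv ℝ F (s₀, t₀) (0, 1) ≠ 0) :
    ∃ τ : ℝ → ℝ, AnalyticAt ℝ τ s₀ ∧ τ s₀ = t₀ ∧ ∀ᶠ x in 𝓝 (s₀, t₀), F x = 0 → x.2 = τ x.1 := by
  have cdf : ContDiffAt ℝ (⊤ : WithTop ℕ∞) F (s₀, t₀) := hF.contDiffAt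
  have hinv : (fderiv ℝ F (s₀, t₀) ∘L .inr ℝ ℝ ℝ).IsInvertible := by
    refine ⟨ContinuousLinearEquiv.unitsEquivAut ℝ (Units.mk0 _ h1), ?_⟩
    ext
    simp
  refine ⟨cdf.implicitFunction (by simp) hinv,
    (cdf.contDiffAt_implicitFunction (by simp) hinv).analyticAt,
    cdf.implicitFunction_apply_self (by simp) hinv, ?_⟩
  filter_upwards [cdf.eventually_apply_eq_iff_implicitFunction (by simp) hinv] with x hx hx0
  exact (hx.1 (hx0.trans h0.symm)).symm

lemma sign_eventually {Y : Type*} [TopologicalSpace Y] (g : Y → ℝ) (y : Y) (hg : ContinuousAt g y)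
    (σ : SignType) (hσ : σ ≠ 0) (h : SignType.sign (g y) = σ) :
    ∀ᶠ z in 𝓝 y, SignType.sign (g z) = σ := by
  rcases σ with _ | _ | _
  · exact absurd rfl hσ
  · have h' : g y < 0 := sign_eq_neg_one_iff.1 h
    filter_upwards [hg.eventually_lt continuousAt_const h'] with z hz
    exact sign_eq_neg_one_iff.2 hz
  · have h' : 0 < g y := sign_eq_one_iff.1 h
    filter_upwards [continuousAt_const.eventually_lt hg h'] with z hz
    exact sign_eq_one_iff.2 hz

lemma arc1 {ι : Type*} [Finite ι] (J : Set ℝ) (hJ : ¬ J.Countable) (Φ : ℝ × ℝ → ℝ)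
    (hΦ : AnalyticOnNhd ℝ Φ (J ×ˢ univ))
    (hne : ∀ s ∈ J, ∀ t, ¬ ∀ᶠ t' in 𝓝 t, Φ (s, t') = 0)
    (φ : ι → ℝ × ℝ → ℝ) (hφ : ∀ i, AnalyticOnNhd ℝ (φ i) (J ×ˢ univ)) (ε : ι → SignType)
    (S : Set ℝ)
    (h : ∀ s ∈ J, ∃ t ∈ S, Φ (s, t) = 0 ∧ ∀ i, SignType.sign (φ i (s, t)) = ε i) :
    ∃ s₀ ∈ J, ∃ τ : ℝ → ℝ, AnalyticAt ℝ τ s₀ ∧ τ s₀ ∈ S ∧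
      ∀ᶠ s in 𝓝 s₀, Φ (s, τ s) = 0 ∧ ∀ i, SignType.sign (φ i (s, τ s)) = ε i := by
  choose! t htS ht0 htφ using h
  set A : ℕ → Set ℝ := fun m => {s ∈ J | itd Φ m (s, t s) = 0 ∧ itd Φ (m + 1) (s, t s) ≠ 0} with hA
  obtain ⟨m, hm⟩ : ∃ m, ¬ (A m).Countable := by
    by_contra hcon
    push Not at hcon
    apply hJ
    refine (countable_iUnion hcon).mono fun s hs => ?_
    obtain ⟨m, hm⟩ := itd_exists Φ J hΦ s hs (t s) (hne s hs _) (ht0 s hs)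
    exact mem_iUnion.2 ⟨m, hs, hm⟩
  have hZ : ¬ ((fun s => (s, t s)) '' A m).Countable := by
    intro hc
    apply hm
    refine countable_of_injective_of_countable_image ?_ hc
    intro a _ b _ hab
    exact (Prod.ext_iff.1 hab).1
  obtain ⟨x, ⟨s₀, hs₀, rfl⟩, hfr⟩ := exists_frequently_of_not_countable _ hZ
  obtain ⟨hs₀J, hF0, hF1⟩ := hs₀
  have hmem : (s₀, t s₀) ∈ J ×ˢ (univ : Set ℝ) := ⟨hs₀J, mem_univ _⟩
  obtain ⟨τ, hτ, hτ0, hτe⟩ := implicit_arc (itd Φ m) s₀ (t s₀)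
    (itd_analytic Φ _ hΦ m _ hmem) hF0 hF1
  have hfr2 : ∃ᶠ s in 𝓝[≠] s₀, s ∈ J ∧ t s = τ s := by
    have h1 : Tendsto (Prod.fst : ℝ × ℝ → ℝ) (𝓝[((fun s => (s, t s)) '' A m) \ {(s₀, t s₀)}] (s₀, t s₀))
        (𝓝[≠] s₀) := by
      refine tendsto_nhdsWithin_of_tendsto_nhds_of_eventually_within _
        (continuous_fst.continuousAt.tendsto.mono_left nhdsWithin_le_nhds) ?_
      filter_upwards [self_mem_nhdsWithin] with y hy
      obtain ⟨⟨s, hs, rfl⟩, hne⟩ := hy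
      intro he
      apply hne
      have : s = s₀ := he
      simp [this]
    refine h1.frequently ?_
    have h2 : ∀ᶠ y in 𝓝[≠] (s₀, t s₀), itd Φ m y = 0 → y.2 = τ y.1 :=
      hτe.filter_mono nhdsWithin_le_nhds
    have h3 := (hfr.and_eventually h2).and_eventually self_mem_nhdsWithin
    rw [frequently_iff]
    intro V hV
    rw [mem_nhdsWithin_iff_eventually] at hV
    obtain ⟨y, ⟨⟨hy1, hy2⟩, hy3⟩, hy4⟩ := (h3.and_eventually (hV.filter_mono nhdsWithin_le_nhds)).exists
    refine ⟨y, hy4 ⟨hy1, hy3⟩, ?_⟩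
    obtain ⟨s, hs, rfl⟩ := hy1
    exact ⟨hs.1, hy2 hs.2.1⟩
  have hpan : AnalyticAt ℝ (fun s => (s, τ s)) s₀ := analyticAt_id.prod hτ
  have hcomp : ∀ g : ℝ × ℝ → ℝ, AnalyticOnNhd ℝ g (J ×ˢ univ) →
      AnalyticAt ℝ (fun s => g (s, τ s)) s₀ := by
    intro g hg
    exact AnalyticAt.fun_comp (g := g) (hg _ ⟨hs₀J, mem_univ _⟩) hpan
  have hzero : ∀ g : ℝ × ℝ → ℝ, AnalyticOnNhd ℝ g (J ×ˢ univ) → (∀ s ∈ J, g (s, t s) = 0) →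
      ∀ᶠ s in 𝓝 s₀, g (s, τ s) = 0 := by
    intro g hg h0
    rw [← (hcomp g hg).frequently_zero_iff_eventually_zero]
    refine hfr2.mono ?_
    rintro s ⟨hs, hst⟩
    rw [← hst]; exact h0 s hs
  refine ⟨s₀, hs₀J, τ, hτ, hτ0 ▸ htS s₀ hs₀J, ?_⟩
  rw [eventually_and, eventually_all]
  refine ⟨hzero Φ hΦ ht0, fun i => ?_⟩
  by_cases hi : ε i = 0
  · have := hzero (φ i) (hφ i) (fun s hs => by
      have := htφ s hs i
      rw [hi] at this
      exact sign_eq_zero_iff.1 this)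
    filter_upwards [this] with s hs
    rw [hs, hi, sign_zero]
  · refine sign_eventually _ s₀ (hcomp _ (hφ i)).continuousAt _ hi ?_
    rw [hτ0]; exact htφ s₀ hs₀J i

/-- Germs of analytic functions at the origin (as functions). -/
noncomputable def An (n : ℕ) : Subring ((Fin n → ℝ) → ℝ) where
  carrier := {h | AnalyticAt ℝ h 0}
  mul_mem' := fun h1 h2 => AnalyticAt.mul h1 h2
  one_mem' := analyticAt_const
  add_mem' := fun h1 h2 => AnalyticAt.add h1 h2
  zero_mem' := analyticAt_const
  neg_mem' := fun h => AnalyticAt.neg h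

/-- Evaluation at a point. -/
noncomputable def evA {n : ℕ} (y : Fin n → ℝ) : An n →+* ℝ :=
  (Pi.evalRingHom (fun _ => ℝ) y).comp (An n).subtype

lemma evA_apply {n : ℕ} (y : Fin n → ℝ) (h : An n) : evA y h = h.1 y := rfl

/-- The arc property in dimension `n`. -/
def ArcProp (E : Type) [NormedAddCommGroup E] [NormedSpace ℝ E] : Prop :=
  ∀ (ι : Type) [Finite ι] (c : ι → E → ℝ), (∀ i, AnalyticAt ℝ (c i) 0) →
    ∀ ε : ι → SignType, (∃ᶠ x in 𝓝[≠] (0 : E), ∀ i, SignType.sign (c i x) = ε i) →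
    ∀ U ∈ 𝓝 (0 : E), ∃ γ : ℝ → E, AnalyticOnNhd ℝ γ (Ioo (-1 : ℝ) 1) ∧
      (∃ t₁ ∈ Ioo (-1 : ℝ) 1, ∃ t₂ ∈ Ioo (-1 : ℝ) 1, γ t₁ ≠ γ t₂) ∧
      ∀ s ∈ Ioo (-1 : ℝ) 1, γ s ∈ U ∧ ∀ i, SignType.sign (c i (γ s)) = ε i

lemma frequently_sign {Y ι : Type*} [Finite ι] (l : Filter Y) (p : Y → Prop) (c : ι → Y → ℝ)
    (h : ∃ᶠ y in l, p y) :
    ∃ σ : ι → SignType, ∃ᶠ y in l, p y ∧ ∀ i, SignType.sign (c i y) = σ i := by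
  by_contra hcon
  push Not at hcon
  have : ∀ᶠ y in l, ∀ σ : ι → SignType, p y → ∃ i, SignType.sign (c i y) ≠ σ i :=
    eventually_all.2 hcon
  obtain ⟨y, hy, hy2⟩ := (h.and_eventually this).exists
  obtain ⟨i, hi⟩ := hy2 (fun i => SignType.sign (c i y)) hy
  exact hi rfl

/-- From a local arc around `s₀` we get an arc on `(-1, 1)`. -/
lemma rescale_arc {E : Type} [NormedAddCommGroup E] [NormedSpace ℝ E] [CompleteSpace E] (Q : E → Prop) (γ : ℝ → E)
    (s₀ : ℝ) (hγ : AnalyticAt ℝ γ s₀) (hQ : ∀ᶠ s in 𝓝 s₀, Q (γ s))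
    (hn : ¬ ∀ᶠ s in 𝓝 s₀, γ s = γ s₀) :
    ∃ γ' : ℝ → E, AnalyticOnNhd ℝ γ' (Ioo (-1 : ℝ) 1) ∧
      (∃ t₁ ∈ Ioo (-1 : ℝ) 1, ∃ t₂ ∈ Ioo (-1 : ℝ) 1, γ' t₁ ≠ γ' t₂) ∧
      ∀ s ∈ Ioo (-1 : ℝ) 1, Q (γ' s) := by
  obtain ⟨η, hη, hball⟩ := Metric.eventually_nhds_iff_ball.1 (hγ.eventually_analyticAt.and hQ)
  have hm : ∀ s ∈ Ioo (-1 : ℝ) 1, s₀ + η * s ∈ Metric.ball s₀ η := by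
    intro s hs
    rw [Metric.mem_ball, Real.dist_eq, add_sub_cancel_left, abs_mul, abs_of_pos hη]
    have := abs_lt.2 hs
    nlinarith
  refine ⟨fun s => γ (s₀ + η * s), ?_, ?_, fun s hs => (hball _ (hm s hs)).2⟩
  · intro s hs
    have h1 : AnalyticAt ℝ (fun s : ℝ => s₀ + η * s) s := by fun_prop
    exact AnalyticAt.fun_comp (g := γ) (hball _ (hm s hs)).1 h1
  · by_contra hcon
    push Not at hcon
    apply hn
    filter_upwards [Metric.ball_mem_nhds s₀ hη] with s hs
    have hs' : (s - s₀) / η ∈ Ioo (-1 : ℝ) 1 := by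
      rw [Metric.mem_ball, Real.dist_eq] at hs
      rw [mem_Ioo, ← abs_lt, abs_div, abs_of_pos hη, div_lt_one hη]
      exact hs
    have := hcon _ hs' 0 (by simp)
    rw [mul_div_cancel₀ _ hη.ne'] at this
    simpa using this

lemma prod_step (n : ℕ) (IH : ArcProp (Fin n → ℝ)) {ι : Type} [Finite ι]
    (c : ι → (Fin n → ℝ) × ℝ → ℝ) (hc : ∀ i, AnalyticAt ℝ (c i) 0) (ε : ι → SignType)
    (i₀ : ι) (hi₀ : ε i₀ = 0) (hne : ¬ ∀ᶠ t in 𝓝 (0 : ℝ), c i₀ (0, t) = 0)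
    (hfr : ∃ᶠ x in 𝓝[≠] (0 : (Fin n → ℝ) × ℝ), ∀ i, SignType.sign (c i x) = ε i)
    (U : Set ((Fin n → ℝ) × ℝ)) (hU : U ∈ 𝓝 0) :
    ∃ γ : ℝ → (Fin n → ℝ) × ℝ, AnalyticOnNhd ℝ γ (Ioo (-1 : ℝ) 1) ∧
      (∃ t₁ ∈ Ioo (-1 : ℝ) 1, ∃ t₂ ∈ Ioo (-1 : ℝ) 1, γ t₁ ≠ γ t₂) ∧
      ∀ s ∈ Ioo (-1 : ℝ) 1, γ s ∈ U ∧ ∀ i, SignType.sign (c i (γ s)) = ε i := by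
  classical
  obtain ⟨b, a, ha, ha0, hiff, hdiv⟩ := weier n (c i₀) (hc i₀) hne
  choose r hr hrdiv using fun i => hdiv (c i) (hc i)
  -- a good box
  have hgood : ∀ᶠ x in 𝓝 (0 : (Fin n → ℝ) × ℝ),
      (c i₀ x = 0 ↔ x.2 ^ b + ∑ j, a j x.1 * x.2 ^ (j : ℕ) = 0) ∧
      (∀ i, c i₀ x = 0 → c i x = ∑ j, r i j x.1 * x.2 ^ (j : ℕ)) ∧ x ∈ U :=
    hiff.and ((eventually_all.2 hrdiv).and hU)
  obtain ⟨η, hη, hbox⟩ := Metric.eventually_nhds_iff_ball.1 hgood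
  have hbox' : ∀ y : Fin n → ℝ, ∀ t : ℝ, ‖y‖ < η → |t| < η →
      (c i₀ (y, t) = 0 ↔ t ^ b + ∑ j, a j y * t ^ (j : ℕ) = 0) ∧
      (∀ i, c i₀ (y, t) = 0 → c i (y, t) = ∑ j, r i j y * t ^ (j : ℕ)) ∧ (y, t) ∈ U := by
    intro y t hy ht
    refine hbox (y, t) ?_
    rw [mem_ball_zero_iff, Prod.norm_def]
    exact max_lt hy ht
  set D : ℝ := η / 2 with hD
  have hD0 : 0 < D := by positivity
  have hDη : D < η := by linarith
  -- polynomials over the ring of germs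
  set aR : Fin b → An n := fun j => ⟨a j, ha j⟩ with haR
  set rR : ι → Fin b → An n := fun i j => ⟨r i j, hr i j⟩ with hrR
  set PP : (An n)[X] := X ^ b + ∑ j, C (aR j) * X ^ (j : ℕ) with hPP
  set RR : ι → (An n)[X] := fun i => ∑ j, C (rR i j) * X ^ (j : ℕ) with hRR
  have evP : ∀ y t, (PP.map (evA y)).eval t = t ^ b + ∑ j, a j y * t ^ (j : ℕ) := by
    intro y t
    simp [hPP, Polynomial.eval_finsetSum, Polynomial.map_sum, evA_apply, haR]
  have evR : ∀ i y t, ((RR i).map (evA y)).eval t = ∑ j, r i j y * t ^ (j : ℕ) := by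
    intro i y t
    simp [hRR, Polynomial.eval_finsetSum, Polynomial.map_sum, evA_apply, hrR]
  have := Fintype.ofFinite ι
  obtain ⟨K, hK⟩ := elim (⟨fun _ => D, analyticAt_const⟩ : An n)
    (insert PP (Finset.univ.image RR))
  -- the projected set accumulates at the origin
  set T' : Set (Fin n → ℝ) := {y | ∃ t ∈ Icc (-D) D, t ^ b + ∑ j, a j y * t ^ (j : ℕ) = 0 ∧
    ∀ i, SignType.sign (∑ j, r i j y * t ^ (j : ℕ)) = ε i} with hT'
  have hfr' : ∃ᶠ y in 𝓝[≠] (0 : Fin n → ℝ), y ∈ T' := by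
    rw [frequently_iff]
    intro V hV
    rw [mem_nhdsWithin_iff_eventually] at hV
    have hfst : Tendsto (Prod.fst : (Fin n → ℝ) × ℝ → (Fin n → ℝ)) (𝓝 0) (𝓝 0) :=
      continuous_fst.tendsto (0 : (Fin n → ℝ) × ℝ)
    have h1 := ((hfst.eventually hV).and (Metric.ball_mem_nhds (0 : (Fin n → ℝ) × ℝ) hD0))
    obtain ⟨⟨y, t⟩, ⟨h2, h3⟩, h4, h5⟩ := ((hfr.and_eventually self_mem_nhdsWithin).and_eventually
      (h1.filter_mono nhdsWithin_le_nhds)).exists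
    rw [dist_zero_right, Prod.norm_def, max_lt_iff] at h5
    have hyn : ‖y‖ < D := h5.1
    have htn : |t| < D := h5.2
    obtain ⟨b1, b2, b3⟩ := hbox' y t (hyn.trans hDη) (htn.trans hDη)
    have hf0 : c i₀ (y, t) = 0 := by
      have := h2 i₀
      rw [hi₀] at this
      exact sign_eq_zero_iff.1 this
    have hP0 := b1.1 hf0
    refine ⟨y, h4 ?_, t, ⟨(abs_lt.1 htn).1.le, (abs_lt.1 htn).2.le⟩, hP0, fun i => ?_⟩
    · intro hy0
      apply h3
      have hy0' : y = 0 := hy0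
      rw [hy0'] at hP0
      simp only [ha0, zero_mul, Finset.sum_const_zero, add_zero] at hP0
      have ht0 := eq_zero_of_pow_eq_zero hP0
      rw [hy0', ht0]; rfl
    · rw [← b2 i hf0]; exact h2 i
  obtain ⟨σ, hσ⟩ := frequently_sign (ι := K) _ _ (fun k y => k.1.1 y) hfr'
  have hnb : ∀ᶠ y in 𝓝 (0 : Fin n → ℝ), ‖y‖ < η ∧ (∀ j, AnalyticAt ℝ (a j) y) ∧
      ∀ i j, AnalyticAt ℝ (r i j) y := by
    refine Filter.Eventually.and ?_ (Filter.Eventually.and ?_ ?_)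
    · filter_upwards [Metric.ball_mem_nhds (0 : Fin n → ℝ) hη] with y hy
      simpa using hy
    · exact eventually_all.2 fun j => (ha j).eventually_analyticAt
    · exact eventually_all.2 fun i => eventually_all.2 fun j => (hr i j).eventually_analyticAt
  obtain ⟨δ, hδan, hδnc, hδ⟩ := IH K (fun k y => k.1.1 y) (fun k => k.1.2) σ
    (hσ.mono fun y hy => hy.2) _ hnb
  obtain ⟨y₀, ⟨t₀, ht₀, hP₀, hr₀⟩, hy₀σ⟩ := hσ.exists
  -- lifting
  have hlift : ∀ s ∈ Ioo (-1 : ℝ) 1, ∃ t ∈ Icc (-D) D, δ s ∈ {y | ‖y‖ < η} ∧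
      t ^ b + ∑ j, a j (δ s) * t ^ (j : ℕ) = 0 ∧
      ∀ i, SignType.sign (∑ j, r i j (δ s) * t ^ (j : ℕ)) = ε i := by
    intro s hs
    obtain ⟨hs1, hs2⟩ := hδ s hs
    obtain ⟨t', ht', hsg⟩ := hK (evA y₀) (evA (δ s)) D hD0 rfl rfl
      (fun k hk => (hy₀σ ⟨k, hk⟩).trans (hs2 ⟨k, hk⟩).symm) t₀ ht₀
    refine ⟨t', ht', hs1.1, ?_, fun i => ?_⟩
    · have := hsg PP (Finset.mem_insert_self _ _)
      rw [evP, evP, hP₀, sign_zero] at this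
      exact sign_eq_zero_iff.1 this.symm
    · have := hsg (RR i) (Finset.mem_insert_of_mem (Finset.mem_image_of_mem _ (Finset.mem_univ i)))
      rw [evR, evR, hr₀ i] at this
      exact this.symm
  have hcoef : ∀ g : (Fin n → ℝ) → ℝ, (∀ s ∈ Ioo (-1 : ℝ) 1, AnalyticAt ℝ g (δ s)) → ∀ k : ℕ,
      AnalyticOnNhd ℝ (fun x : ℝ × ℝ => g (δ x.1) * x.2 ^ k) (Ioo (-1 : ℝ) 1 ×ˢ univ) := by
    intro g hg k x hx
    have h1 : AnalyticAt ℝ (fun x : ℝ × ℝ => δ x.1) x :=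
      AnalyticAt.fun_comp (g := δ) (hδan x.1 hx.1) analyticAt_fst
    have h2 : AnalyticAt ℝ (fun x : ℝ × ℝ => g (δ x.1)) x :=
      AnalyticAt.fun_comp (g := g) (hg x.1 hx.1) h1
    exact h2.mul (analyticAt_snd.pow k)
  obtain ⟨s₀, hs₀, τ, hτ, hτS, hτe⟩ := arc1 (Ioo (-1 : ℝ) 1)
    (by
      intro hcount
      have := Cardinal.mk_Ioo_real (show (-1 : ℝ) < 1 by norm_num)
      have h2 := Cardinal.le_aleph0_iff_set_countable.2 hcount
      rw [this] at h2
      exact absurd h2 (not_le.2 Cardinal.aleph0_lt_continuum))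
    (fun x => x.2 ^ b + ∑ j, a j (δ x.1) * x.2 ^ (j : ℕ))
    (by
      intro x hx
      refine AnalyticAt.add (analyticAt_snd.pow b) ?_
      exact Finset.analyticAt_fun_sum _ fun j _ => hcoef (a j) (fun s hs => (hδ s hs).1.2.1 j) j x hx)
    (by
      intro s hs t hev
      have hpol : ∀ t', ((PP.map (evA (δ s)))).eval t' = t' ^ b + ∑ j, a j (δ s) * t' ^ (j : ℕ) :=
        evP (δ s)
      have hmonic : (PP.map (evA (δ s))).Monic := by
        apply Polynomial.Monic.map
        rw [hPP]
        apply Polynomial.monic_X_pow_add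
        refine (Polynomial.degree_sum_le _ _).trans_lt ?_
        refine (Finset.sup_lt_iff (WithBot.bot_lt_coe b)).2 ?_
        intro j _
        exact (Polynomial.degree_C_mul_X_pow_le _ _).trans_lt (Nat.cast_lt.2 j.2)
      have hfin := (PP.map (evA (δ s))).rootSet_finite ℝ
      have hsub : {t' | t' ^ b + ∑ j, a j (δ s) * t' ^ (j : ℕ) = 0} ∈ 𝓝 t := hev
      have hinf : {t' | t' ^ b + ∑ j, a j (δ s) * t' ^ (j : ℕ) = 0}.Infinite :=
        infinite_of_mem_nhds t hsub
      apply hinf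
      refine hfin.subset fun t' ht' => ?_
      rw [Polynomial.mem_rootSet]
      refine ⟨hmonic.ne_zero, ?_⟩
      rw [Polynomial.coe_aeval_eq_eval, hpol]
      exact ht')
    (fun i x => ∑ j, r i j (δ x.1) * x.2 ^ (j : ℕ))
    (by
      intro i x hx
      exact Finset.analyticAt_fun_sum _ fun j _ =>
        hcoef (r i j) (fun s hs => (hδ s hs).1.2.2 i j) j x hx)
    ε (Icc (-D) D)
    (fun s hs => by
      obtain ⟨t, h1, -, h2, h3⟩ := hlift s hs
      exact ⟨t, h1, h2, h3⟩)
  refine rescale_arc (fun x => x ∈ U ∧ ∀ i, SignType.sign (c i x) = ε i) (fun s => (δ s, τ s)) s₀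
    ((hδan s₀ hs₀).prod hτ) ?_ ?_
  · have hτb : ∀ᶠ s in 𝓝 s₀, |τ s| < η := by
      refine hτ.continuousAt.abs.eventually_lt continuousAt_const ?_
      exact (abs_le.2 hτS).trans_lt hDη
    filter_upwards [hτe, hτb, isOpen_Ioo.mem_nhds hs₀] with s h1 h2 h3
    obtain ⟨b1, b2, b3⟩ := hbox' (δ s) (τ s) (hδ s h3).1.1 h2
    have hf0 := b1.2 h1.1
    refine ⟨b3, fun i => ?_⟩
    rw [b2 i hf0]; exact h1.2 i
  · intro hev
    have h1 : δ =ᶠ[𝓝 s₀] fun _ => δ s₀ := by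
      filter_upwards [hev] with s hs
      exact (Prod.ext_iff.1 hs).1
    have h2 := hδan.eqOn_of_preconnected_of_eventuallyEq (fun _ _ => analyticAt_const)
      isPreconnected_Ioo hs₀ h1
    obtain ⟨t₁, ht₁, t₂, ht₂, hne⟩ := hδnc
    exact hne ((h2 ht₁).trans (h2 ht₂).symm)

lemma open_case {E : Type} [NormedAddCommGroup E] [NormedSpace ℝ E] [CompleteSpace E]
    {ι : Type} [Finite ι] (c : ι → E → ℝ) (hc : ∀ i, AnalyticAt ℝ (c i) 0) (ε : ι → SignType)
    (hfr : ∃ᶠ x in 𝓝[≠] (0 : E), ∀ i, SignType.sign (c i x) = ε i)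
    (hz : ∀ i, ε i = 0 → ∀ᶠ x in 𝓝 (0 : E), c i x = 0) (U : Set E) (hU : U ∈ 𝓝 0) :
    ∃ γ : ℝ → E, AnalyticOnNhd ℝ γ (Ioo (-1 : ℝ) 1) ∧
      (∃ t₁ ∈ Ioo (-1 : ℝ) 1, ∃ t₂ ∈ Ioo (-1 : ℝ) 1, γ t₁ ≠ γ t₂) ∧
      ∀ s ∈ Ioo (-1 : ℝ) 1, γ s ∈ U ∧ ∀ i, SignType.sign (c i (γ s)) = ε i := by
  have h1 : ∀ᶠ x in 𝓝 (0 : E), ∀ᶠ y in 𝓝 x, (∀ i, ε i = 0 → c i y = 0) ∧ y ∈ U := by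
    refine Filter.Eventually.eventually_nhds ?_
    refine Filter.Eventually.and ?_ hU
    refine eventually_all.2 fun i => ?_
    by_cases h : ε i = 0
    · filter_upwards [hz i h] with x hx _ using hx
    · exact Eventually.of_forall fun x h' => absurd h' h
  have h2 : ∀ᶠ x in 𝓝 (0 : E), ∀ i, AnalyticAt ℝ (c i) x :=
    eventually_all.2 fun i => (hc i).eventually_analyticAt
  obtain ⟨x, ⟨hx1, hx0⟩, hx2, hx3⟩ := ((hfr.and_eventually self_mem_nhdsWithin).and_eventually
    ((h1.and h2).filter_mono nhdsWithin_le_nhds)).exists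
  have hx0' : x ≠ 0 := hx0
  have h4 : ∀ᶠ y in 𝓝 x, y ∈ U ∧ ∀ i, SignType.sign (c i y) = ε i := by
    refine (hx2.mono fun y hy => hy.2).and (eventually_all.2 fun i => ?_)
    by_cases h : ε i = 0
    · filter_upwards [hx2] with y hy
      rw [hy.1 i h, h, sign_zero]
    · exact sign_eventually _ x (hx3 i).continuousAt _ h (hx1 i)
  have hline : AnalyticAt ℝ (fun s : ℝ => x + s • x) 0 :=
    analyticAt_const.add (analyticAt_id.smul analyticAt_const)
  refine rescale_arc (fun y => y ∈ U ∧ ∀ i, SignType.sign (c i y) = ε i) (fun s => x + s • x) 0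
    hline ?_ ?_
  · have : Tendsto (fun s : ℝ => x + s • x) (𝓝 0) (𝓝 x) := by
      simpa using hline.continuousAt.tendsto
    exact this.eventually h4
  · intro hev
    obtain ⟨s, hs, hs0⟩ := ((hev.filter_mono nhdsWithin_le_nhds).and
      (self_mem_nhdsWithin : ({0}ᶜ : Set ℝ) ∈ 𝓝[≠] 0)).exists
    simp only [zero_smul, add_zero, add_eq_left, smul_eq_zero] at hs
    exact hs.elim hs0 hx0'

lemma exists_direction {E : Type} [NormedAddCommGroup E] [NormedSpace ℝ E] (f : E → ℝ)
    (hf : AnalyticAt ℝ f 0) (h0 : f 0 = 0) (hne : ¬ ∀ᶠ x in 𝓝 (0 : E), f x = 0) :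
    ∃ v : E, v ≠ 0 ∧ ¬ ∀ᶠ t in 𝓝 (0 : ℝ), f (t • v) = 0 := by
  obtain ⟨η, hη, hball⟩ := Metric.eventually_nhds_iff_ball.1 hf.eventually_analyticAt
  obtain ⟨x, hx, hxb⟩ := ((not_eventually.1 hne).and_eventually
    (Metric.ball_mem_nhds (0 : E) hη)).exists
  refine ⟨x, ?_, fun hev => hx ?_⟩
  · rintro rfl; exact hx h0
  · set J : Set ℝ := {t | t • x ∈ Metric.ball (0 : E) η} with hJ
    have hJc : Convex ℝ J :=
      (convex_ball (0 : E) η).linear_preimage (LinearMap.toSpanSingleton ℝ E x)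
    have han : AnalyticOnNhd ℝ (fun t : ℝ => f (t • x)) J := by
      intro t ht
      have h1 : AnalyticAt ℝ (fun t : ℝ => t • x) t := analyticAt_id.smul analyticAt_const
      exact AnalyticAt.fun_comp (g := f) (hball _ ht) h1
    have h1 := han.eqOn_zero_of_preconnected_of_eventuallyEq_zero hJc.isPreconnected
      (z₀ := 0) (by simp [hJ, hη]) hev
    have h2 := h1 (show (1 : ℝ) ∈ J by
      show (1 : ℝ) • x ∈ Metric.ball (0 : E) η
      rw [one_smul, Metric.mem_ball]; exact hxb)
    simpa using h2

theorem arc_main (n : ℕ) : ArcProp (Fin n → ℝ) := by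
  induction n with
  | zero =>
    intro ι _ c hc ε hfr U hU
    obtain ⟨x, -, hx⟩ := (hfr.and_eventually self_mem_nhdsWithin).exists
    exact absurd (Subsingleton.elim x 0) hx
  | succ n IH =>
    intro ι _ c hc ε hfr U hU
    by_cases hz : ∀ i, ε i = 0 → ∀ᶠ x in 𝓝 (0 : Fin (n + 1) → ℝ), c i x = 0
    · exact open_case c hc ε hfr hz U hU
    push Not at hz
    obtain ⟨i₀, hi₀, hne⟩ := hz
    have hf0 : c i₀ 0 = 0 := by
      by_contra h
      have h1 : ∀ᶠ x in 𝓝[≠] (0 : Fin (n + 1) → ℝ), c i₀ x ≠ 0 :=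
        ((hc i₀).continuousAt.eventually_ne h).filter_mono nhdsWithin_le_nhds
      obtain ⟨x, hx, hx'⟩ := (hfr.and_eventually h1).exists
      have := hx i₀
      rw [hi₀] at this
      exact hx' (sign_eq_zero_iff.1 this)
    obtain ⟨v, hv, hvne⟩ := exists_direction (c i₀) (hc i₀) hf0 (by simpa using hne)
    have hdim : Module.finrank ℝ ((Fin n → ℝ) × ℝ) = Module.finrank ℝ (Fin (n + 1) → ℝ) := by simp
    set L₀ : ((Fin n → ℝ) × ℝ) ≃L[ℝ] (Fin (n + 1) → ℝ) := ContinuousLinearEquiv.ofFinrankEq hdim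
    have hL₀ : L₀ (0, 1) ≠ 0 := by
      intro h
      have := (L₀.map_eq_zero_iff).1 h
      exact one_ne_zero (Prod.ext_iff.1 this).2
    obtain ⟨A, hA⟩ := SeparatingDual.exists_continuousLinearEquiv_apply_eq (R := ℝ) hL₀ hv
    set L : ((Fin n → ℝ) × ℝ) ≃L[ℝ] (Fin (n + 1) → ℝ) := L₀.trans A with hL
    have hL1 : L (0, 1) = v := hA
    have hLt : ∀ t : ℝ, L (0, t) = t • v := by
      intro t
      rw [← hL1, ← map_smul]; simp
    have hLan : ∀ x, AnalyticAt ℝ L x := fun x =>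
      (L : ((Fin n → ℝ) × ℝ) →L[ℝ] (Fin (n + 1) → ℝ)).analyticAt x
    obtain ⟨γ, h1, ⟨t₁, ht₁, t₂, ht₂, h2⟩, h3⟩ := prod_step n IH (fun i x => c i (L x))
      (fun i => AnalyticAt.fun_comp (g := c i) (by simpa using hc i) (hLan 0)) ε i₀ hi₀
      (by simpa [hLt] using hvne)
      (by
        have ht : Tendsto L.symm (𝓝[≠] 0) (𝓝[≠] 0) := by
          refine tendsto_nhdsWithin_of_tendsto_nhds_of_eventually_within _ ?_ ?_
          · have := L.symm.continuous.tendsto 0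
            rw [map_zero] at this
            exact this.mono_left nhdsWithin_le_nhds
          · filter_upwards [self_mem_nhdsWithin] with x hx h
            exact hx ((L.symm.map_eq_zero_iff).1 h)
        refine ht.frequently ?_
        simpa using hfr)
      (L ⁻¹' U) (by
        apply L.continuous.continuousAt
        simpa using hU)
    refine ⟨fun s => L (γ s), fun s hs => AnalyticAt.fun_comp (g := L) (hLan _) (h1 s hs),
      ⟨t₁, ht₁, t₂, ht₂, fun h => h2 (L.injective h)⟩, fun s hs => h3 s hs⟩

end ArcSel

open Filter Topology

/-- Lemma 3.5: for the common zero set `X` of finitely many real analytic functions on a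
neighborhood `𝒰` of `0` in `ℝⁿ`, and `W` the common zero set of finitely many real analytic
functions with `0 ∈ W`, either `X ∖ W` can be made empty by shrinking `𝒰`, or `X ∖ W`
contains the image of a nonconstant real analytic path. -/
theorem stmt_2 (n p q : ℕ) (𝒰 : Set (Fin n → ℝ)) (h𝒰 : IsOpen 𝒰) (h0 : 0 ∈ 𝒰)
    (A : Fin p → (Fin n → ℝ) → ℝ) (hA : ∀ i, AnalyticOnNhd ℝ (A i) 𝒰)
    (B : Fin q → (Fin n → ℝ) → ℝ) (hB : ∀ j, AnalyticOnNhd ℝ (B j) 𝒰)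
    (X : Set (Fin n → ℝ)) (hX : X = {x ∈ 𝒰 | ∀ i, A i x = 0})
    (W : Set (Fin n → ℝ)) (hW : W = {x ∈ 𝒰 | ∀ j, B j x = 0})
    (h0W : 0 ∈ W) :
    (∃ 𝒰' : Set (Fin n → ℝ), IsOpen 𝒰' ∧ 0 ∈ 𝒰' ∧ 𝒰' ⊆ 𝒰 ∧
      (X \ W) ∩ 𝒰' = ∅) ∨
    (∃ γ : ℝ → (Fin n → ℝ), AnalyticOnNhd ℝ γ (Ioo (-1 : ℝ) 1) ∧
      (∃ t₁ ∈ Ioo (-1 : ℝ) 1, ∃ t₂ ∈ Ioo (-1 : ℝ) 1, γ t₁ ≠ γ t₂) ∧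
      γ '' Ioo (-1 : ℝ) 1 ⊆ X \ W) := by
  by_cases hev : ∀ᶠ x in 𝓝 (0 : Fin n → ℝ), x ∉ X \ W
  · left
    obtain ⟨V, hV, hVo, hV0⟩ := eventually_nhds_iff.1 hev
    refine ⟨V ∩ 𝒰, hVo.inter h𝒰, ⟨hV0, h0⟩, inter_subset_right, ?_⟩
    ext x
    simp only [mem_inter_iff, mem_empty_iff_false, iff_false]
    rintro ⟨h1, h2, -⟩
    exact hV x h2 h1
  · right
    have hfr : ∃ᶠ x in 𝓝[≠] (0 : Fin n → ℝ), x ∈ X \ W := by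
      rw [frequently_nhdsWithin_iff]
      refine (not_eventually.1 hev).mono fun x hx => ?_
      have hx' := not_not.1 hx
      refine ⟨hx', fun h => hx'.2 ?_⟩
      have h' : x = 0 := h
      rw [h']; exact h0W
    set c : Fin p ⊕ Fin q → (Fin n → ℝ) → ℝ := Sum.elim A B with hc
    obtain ⟨σ, hσ⟩ := ArcSel.frequently_sign _ _ c hfr
    obtain ⟨y, hy, hyσ⟩ := hσ.exists
    obtain ⟨γ, h1, h2, h3⟩ := ArcSel.arc_main n (Fin p ⊕ Fin q) c
      (by rintro (i | j)
          · exact hA i 0 h0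
          · exact hB j 0 h0) σ (hσ.mono fun x hx => hx.2) 𝒰 (h𝒰.mem_nhds h0)
    refine ⟨γ, h1, h2, ?_⟩
    rintro _ ⟨s, hs, rfl⟩
    obtain ⟨hU, hs3⟩ := h3 s hs
    have hyX := hy.1
    have hyW := hy.2
    rw [hX] at hyX
    rw [hW] at hyW
    have key : ∀ i, c i y = 0 ↔ c i (γ s) = 0 := by
      intro i
      rw [← sign_eq_zero_iff, hyσ i, ← hs3 i, sign_eq_zero_iff]
    rw [hX, hW]
    refine ⟨⟨hU, fun i => (key (Sum.inl i)).1 (hyX.2 i)⟩, fun h => hyW ⟨hyX.1, fun j => ?_⟩⟩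
    exact (key (Sum.inr j)).2 (h.2 j)
end

section
/- Let g ≥ 1 and let Δ ⊆ ℂ be an open disc centered at 0 of radius at most 1. Let F, G : Δ → ℂ^g be holomorphic, let η : Δ → M_g(ℂ) be holomorphic with η(z) symmetric for every z, and let 𝒩 ∈ M_g(ℝ) be symmetric. Assume: (i) 𝒩·F(0) = 0 and G′(z) + (1/(2πi z))·𝒩·F(z) = η(z)·F′(z) for all z ∈ Δ ∖ {0}; (ii) the real symmetric matrix Im η(z) − (log|z|/2π)·𝒩 is positive definite for every z ∈ Δ ∖ {0}. If there exists a sequence z_n ∈ Δ ∖ {0} with z_n → 0 such that Im F(z_n) = 0 and Im G(z_n) − (log|z_n|/2π)·𝒩·Re F(z_n) = 0 for all n, then F and G are constant on Δ. -/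
open Metric Filter Matrix

/-- If `G' = z^k q` near `0`, then `(G z - G 0) / z^(k+1) → q 0 / (k+1)`. -/
lemma aux_lim_div (G q : ℂ → ℂ) (k : ℕ) (hG : AnalyticAt ℂ G 0) (hq : ContinuousAt q 0)
    (h : ∀ᶠ z in nhdsWithin (0 : ℂ) {0}ᶜ, deriv G z = z ^ k * q z) :
    Tendsto (fun z => (G z - G 0) / z ^ (k + 1)) (nhdsWithin (0 : ℂ) {0}ᶜ)
      (nhds (q 0 / ((k : ℂ) + 1))) := by
  have hk : ((k : ℂ) + 1) ≠ 0 := by exact_mod_cast Nat.succ_ne_zero k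
  have h' : deriv G =ᶠ[nhds 0] (fun z => z ^ k * q z) := by
    rw [← ContinuousAt.eventuallyEq_nhds_iff_eventuallyEq_nhdsNE]
    · exact h
    · exact hG.deriv.continuousAt
    · exact (continuousAt_id.pow k).mul hq
  rw [Metric.tendsto_nhdsWithin_nhds]
  intro ε hε
  have hq' : ∀ᶠ z in nhds (0 : ℂ), ‖q z - q 0‖ < ε / 2 := by
    have := Metric.tendsto_nhds.1 hq (ε / 2) (by positivity)
    simpa [dist_eq_norm] using this
  have hall := (h'.and (hq'.and hG.eventually_analyticAt))
  obtain ⟨δ, hδ, hb⟩ := Metric.eventually_nhds_iff.1 hall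
  refine ⟨δ, hδ, ?_⟩
  intro z hz hzd
  have hz0 : z ≠ 0 := hz
  set b := q 0 / ((k : ℂ) + 1) with hbdef
  have key := Convex.norm_image_sub_le_of_norm_deriv_le (𝕜 := ℂ)
    (f := fun w => G w - b * w ^ (k + 1)) (s := closedBall 0 ‖z‖) (x := 0) (y := z)
    (C := ‖z‖ ^ k * (ε / 2)) ?_ ?_ (convex_closedBall _ _) (by simp) (by simp)
  · have e : G z - b * z ^ (k + 1) - (G 0 - b * 0 ^ (k + 1))
        = z ^ (k + 1) * ((G z - G 0) / z ^ (k + 1) - b) := by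
      field_simp
      simp
      ring
    simp only [e, norm_mul, norm_pow, sub_zero] at key
    rw [dist_eq_norm]
    have hp : 0 < ‖z‖ ^ (k + 1) := by positivity
    have : ‖(G z - G 0) / z ^ (k + 1) - b‖ ≤ ε / 2 := by
      refine le_of_mul_le_mul_left ?_ hp
      calc _ ≤ _ := key
        _ = _ := by ring
    linarith
  · intro w hw
    have hwd : dist w 0 < δ := by
      rw [dist_zero_right] at hzd ⊢
      exact lt_of_le_of_lt (by simpa using hw) hzd
    have hd := (hb hwd).2.2.differentiableAt
    fun_prop
  · intro w hw
    have hwz : ‖w‖ ≤ ‖z‖ := by simpa using hw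
    have hwd : dist w 0 < δ := by
      rw [dist_zero_right] at hzd ⊢
      exact lt_of_le_of_lt hwz hzd
    obtain ⟨h1, h2, h3⟩ := hb hwd
    have hder : HasDerivAt (fun w => G w - b * w ^ (k + 1))
        (deriv G w - b * (((k + 1 : ℕ) : ℂ) * w ^ k)) w := by
      have := (hasDerivAt_pow (k + 1) w).const_mul b
      exact h3.differentiableAt.hasDerivAt.sub (by simpa using this)
    rw [hder.deriv, h1]
    have e : w ^ k * q w - b * (((k + 1 : ℕ) : ℂ) * w ^ k) = w ^ k * (q w - q 0) := by
      rw [hbdef]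
      push_cast
      field_simp
    rw [e, norm_mul, norm_pow]
    gcongr

/-- Minimum principle for the imaginary part, from the open mapping theorem. -/
lemma aux_open (ρ : ℝ) (hρ : 0 < ρ) (φ : ℂ → ℂ) (hφ : AnalyticOnNhd ℂ φ (ball 0 ρ))
    (hp : ∀ z ∈ ball (0 : ℂ) ρ, z ≠ 0 → 0 < (φ z).im) : 0 < (φ 0).im := by
  by_contra hcon
  push Not at hcon
  have h0 : (0 : ℂ) ∈ ball (0 : ℂ) ρ := by simpa using hρ
  rcases hφ.is_constant_or_isOpen (convex_ball _ _).isPreconnected with ⟨w, hw⟩ | ho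
  · have hm : ((ρ / 2 : ℝ) : ℂ) ∈ ball (0 : ℂ) ρ := by
      rw [mem_ball_zero_iff, Complex.norm_real, Real.norm_of_nonneg (by positivity)]
      linarith
    have h1 := hp _ hm (by exact_mod_cast (by positivity : ρ / 2 ≠ 0))
    rw [hw _ hm, ← hw _ h0] at h1
    linarith
  · have hi := ho _ subset_rfl isOpen_ball
    obtain ⟨ε, hε, hs⟩ := Metric.isOpen_iff.1 hi (φ 0) ⟨0, h0, rfl⟩
    have hm : φ 0 - ((ε / 2 : ℝ) : ℂ) * Complex.I ∈ ball (φ 0) ε := by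
      rw [mem_ball, dist_eq_norm]
      have : φ 0 - ((ε / 2 : ℝ) : ℂ) * Complex.I - φ 0 = - (((ε / 2 : ℝ) : ℂ) * Complex.I) := by
        ring
      rw [this, norm_neg, norm_mul, Complex.norm_I, Complex.norm_real,
        Real.norm_of_nonneg (by positivity)]
      linarith
    obtain ⟨w, hw, hwe⟩ := hs hm
    have him : (φ w).im = (φ 0).im - ε / 2 := by rw [hwe]; simp
    by_cases hw0 : w = 0
    · subst hw0; linarith
    · have := hp w hw hw0
      linarith

/-- Expansion of the quadratic form. -/
lemma aux_quad {g : ℕ} (A N : Matrix (Fin g) (Fin g) ℝ) (c : ℝ) (h : (A - c • N).PosDef)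
    (y : Fin g → ℝ) (hy : y ≠ 0) :
    0 < (∑ i, y i * ∑ j, A i j * y j) - c * ∑ i, y i * ∑ j, N i j * y j := by
  have h1 := h.dotProduct_mulVec_pos hy
  have e : star y ⬝ᵥ (A - c • N).mulVec y
      = (∑ i, y i * ∑ j, A i j * y j) - c * ∑ i, y i * ∑ j, N i j * y j := by
    simp only [dotProduct, mulVec, star_trivial, Matrix.sub_apply, Matrix.smul_apply, smul_eq_mul,
      Finset.mul_sum, ← Finset.sum_sub_distrib]
    refine Finset.sum_congr rfl fun i _ => Finset.sum_congr rfl fun j _ => ?_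
    ring
  rwa [e] at h1

lemma aux_log (z : ℕ → ℂ) (hzne : ∀ n, z n ≠ 0) (hlim : Tendsto z atTop (nhds 0)) :
    Tendsto (fun n => -(Real.log ‖z n‖ / (2 * Real.pi))) atTop atTop := by
  have h1 : Tendsto (fun n => ‖z n‖) atTop (nhdsWithin 0 (Set.Ioi 0)) := by
    refine tendsto_nhdsWithin_iff.2 ⟨?_, Eventually.of_forall fun n => norm_pos_iff.2 (hzne n)⟩
    simpa using hlim.norm
  have h2 := Real.tendsto_log_nhdsGT_zero.comp h1
  have h3 := (tendsto_neg_atBot_atTop.comp h2).atTop_div_const (r := 2 * Real.pi) (by positivity)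
  refine h3.congr fun n => ?_
  simp [neg_div]

lemma aux_psd {g : ℕ} (ρ : ℝ) (hρ : 0 < ρ) (η : ℂ → Matrix (Fin g) (Fin g) ℂ)
    (N : Matrix (Fin g) (Fin g) ℝ)
    (hη : ∀ i j : Fin g, AnalyticOnNhd ℂ (fun w => η w i j) (ball 0 ρ))
    (hpos : ∀ z ∈ ball (0 : ℂ) ρ, z ≠ 0 →
      (((η z).map Complex.im) - (Real.log ‖z‖ / (2 * Real.pi)) • N).PosDef)
    (z : ℕ → ℂ) (hz : ∀ n, z n ∈ ball (0 : ℂ) ρ) (hzne : ∀ n, z n ≠ 0)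
    (hlim : Tendsto z atTop (nhds 0)) (y : Fin g → ℝ) :
    0 ≤ ∑ i, y i * ∑ j, N i j * y j := by
  by_cases hy : y = 0
  · simp [hy]
  by_contra hcon
  push Not at hcon
  set Q := ∑ i, y i * ∑ j, N i j * y j with hQ
  have hL := aux_log z hzne hlim
  have hηc : ∀ i j, Tendsto (fun n => (η (z n) i j).im) atTop (nhds (η 0 i j).im) := by
    intro i j
    have := ((hη i j 0 (by simpa using hρ)).continuousAt.tendsto).comp hlim
    exact (Complex.continuous_im.tendsto _).comp this
  have hE : Tendsto (fun n => ∑ i, y i * ∑ j, (η (z n) i j).im * y j) atTop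
      (nhds (∑ i, y i * ∑ j, (η 0 i j).im * y j)) :=
    tendsto_finsetSum _ fun i _ => (tendsto_finsetSum _ fun j _ =>
      (hηc i j).mul_const _).const_mul _
  have hbot := (hL.atTop_mul_const_of_neg hcon)
  have hsum := hE.add_atBot hbot
  obtain ⟨n, hn⟩ := (hsum.eventually (eventually_lt_atBot 0)).exists
  have := aux_quad _ N _ (hpos (z n) (hz n) (hzne n)) y hy
  simp only [Matrix.map_apply] at this
  linarith

lemma aux_core (g : ℕ) (ρ : ℝ) (hρ : 0 < ρ)
    (F G : ℂ → Fin g → ℂ) (η : ℂ → Matrix (Fin g) (Fin g) ℂ)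
    (N : Matrix (Fin g) (Fin g) ℝ)
    (hF : AnalyticOnNhd ℂ F (ball 0 ρ)) (hG : AnalyticOnNhd ℂ G (ball 0 ρ))
    (hη : ∀ i j : Fin g, AnalyticOnNhd ℂ (fun w => η w i j) (ball 0 ρ))
    (hNF0 : ∀ i, ∑ j, (N i j : ℂ) * F 0 j = 0)
    (hode : ∀ z ∈ ball (0 : ℂ) ρ, z ≠ 0 → ∀ i,
      deriv (fun w => G w i) z +
        (1 / (2 * (Real.pi : ℂ) * Complex.I * z)) * ∑ j, (N i j : ℂ) * F z j
      = ∑ j, η z i j * deriv (fun w => F w j) z)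
    (hpos : ∀ z ∈ ball (0 : ℂ) ρ, z ≠ 0 →
      (((η z).map Complex.im) - (Real.log ‖z‖ / (2 * Real.pi)) • N).PosDef)
    (z : ℕ → ℂ) (hz : ∀ n, z n ∈ ball (0 : ℂ) ρ) (hzne : ∀ n, z n ≠ 0)
    (hlim : Tendsto z atTop (nhds 0))
    (hImF : ∀ n, ∀ i, (F (z n) i).im = 0)
    (hImG : ∀ n i, (G (z n) i).im =
      (Real.log ‖z n‖ / (2 * Real.pi)) * ∑ j, N i j * (F (z n) j).re)
    (k : ℕ) (f : ℂ → Fin g → ℂ) (hf : AnalyticAt ℂ f 0) (hf0 : f 0 ≠ 0)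
    (hFf : ∀ᶠ w in nhds (0 : ℂ), F w - F 0 = w ^ (k + 1) • f w)
    (u : ℂ) (hu1 : ‖u‖ = 1)
    (hu : Tendsto (fun n => z n ^ (k + 1) / (‖z n‖ : ℂ) ^ (k + 1)) atTop (nhds u)) : False := by
  have h0 : (0 : ℂ) ∈ ball (0 : ℂ) ρ := by simpa using hρ
  have hpi : (Real.pi : ℂ) ≠ 0 := by exact_mod_cast Real.pi_ne_zero
  have hk : ((k : ℂ) + 1) ≠ 0 := by exact_mod_cast Nat.succ_ne_zero k
  have hkr : ((k : ℝ) + 1) ≠ 0 := by positivity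
  have hfi : ∀ i, AnalyticAt ℂ (fun w => f w i) 0 := fun i => analyticAt_pi_iff.1 hf i
  have hGi : ∀ i, AnalyticAt ℂ (fun w => G w i) 0 := fun i => analyticAt_pi_iff.1 (hG 0 h0) i
  have hFi : ∀ i, AnalyticAt ℂ (fun w => F w i) 0 := fun i => analyticAt_pi_iff.1 (hF 0 h0) i
  -- derivative of F
  have hFd : ∀ᶠ w in nhds (0 : ℂ), ∀ j, deriv (fun w => F w j) w
      = w ^ k * (((k : ℂ) + 1) * f w j + w * deriv (fun w => f w j) w) := by
    rw [eventually_all]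
    intro j
    filter_upwards [hFf.eventually_nhds, (hfi j).eventually_analyticAt] with w hw hfw
    have e : (fun w => F w j) =ᶠ[nhds w] fun w => F 0 j + w ^ (k + 1) * f w j := by
      filter_upwards [hw] with y hy
      have := congrFun hy j
      simp only [Pi.sub_apply, Pi.smul_apply, smul_eq_mul] at this
      rw [← this]; ring
    rw [e.deriv_eq]
    have hd := ((hasDerivAt_pow (k + 1) w).mul hfw.differentiableAt.hasDerivAt).const_add (F 0 j)
    refine hd.deriv.trans ?_
    push_cast
    try simp only [Nat.add_sub_cancel]
    ring
  -- the limit of the difference quotient of G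
  have hGlim : ∀ i, Tendsto (fun w => (G w i - G 0 i) / w ^ (k + 1))
      (nhdsWithin (0 : ℂ) {0}ᶜ)
      (nhds ((∑ j, η 0 i j * (((k : ℂ) + 1) * f 0 j)
        - (1 / (2 * (Real.pi : ℂ) * Complex.I)) * ∑ j, (N i j : ℂ) * f 0 j) / ((k : ℂ) + 1))) := by
    intro i
    have hq : ContinuousAt (fun w =>
        ∑ j, η w i j * (((k : ℂ) + 1) * f w j + w * deriv (fun w => f w j) w)
        - (1 / (2 * (Real.pi : ℂ) * Complex.I)) * ∑ j, (N i j : ℂ) * f w j) 0 := by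
      have h1 : ∀ j, ContinuousAt (fun w => η w i j) 0 := fun j => (hη i j 0 h0).continuousAt
      have h2 : ∀ j, ContinuousAt (fun w => f w j) 0 := fun j => (hfi j).continuousAt
      have h3 : ∀ j, ContinuousAt (fun w => deriv (fun w => f w j) w) 0 :=
        fun j => (hfi j).deriv.continuousAt
      refine ContinuousAt.sub (tendsto_finsetSum _ fun j _ => ?_)
        (continuousAt_const.mul (tendsto_finsetSum _ fun j _ => ?_))
      · exact (h1 j).mul ((continuousAt_const.mul (h2 j)).add (continuousAt_id.mul (h3 j)))
      · exact continuousAt_const.mul (h2 j)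
    have := aux_lim_div (fun w => G w i) _ k (hGi i) hq ?_
    · simpa using this
    · have hball : ∀ᶠ w in nhds (0 : ℂ), w ∈ ball (0 : ℂ) ρ := isOpen_ball.mem_nhds h0
      filter_upwards [nhdsWithin_le_nhds hFd, nhdsWithin_le_nhds hFf, nhdsWithin_le_nhds hball,
        self_mem_nhdsWithin] with w hw1 hw2 hw3 hw4
      have hw0 : w ≠ 0 := hw4
      have ho := hode w hw3 hw0 i
      have e1 : ∑ j, (N i j : ℂ) * F w j = w ^ (k + 1) * ∑ j, (N i j : ℂ) * f w j := by
        have : ∑ j, (N i j : ℂ) * F w j = ∑ j, (N i j : ℂ) * F w j - ∑ j, (N i j : ℂ) * F 0 j := by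
          rw [hNF0 i, sub_zero]
        rw [this, ← Finset.sum_sub_distrib, Finset.mul_sum]
        refine Finset.sum_congr rfl fun j _ => ?_
        have := congrFun hw2 j
        simp only [Pi.sub_apply, Pi.smul_apply, smul_eq_mul] at this
        rw [← mul_sub, this]; ring
      have e2 : ∑ j, η w i j * deriv (fun w => F w j) w
          = w ^ k * ∑ j, η w i j * (((k : ℂ) + 1) * f w j + w * deriv (fun w => f w j) w) := by
        rw [Finset.mul_sum]
        refine Finset.sum_congr rfl fun j _ => ?_
        rw [hw1 j]; ring
      rw [e1, e2] at ho
      rw [eq_sub_of_add_eq ho, mul_sub]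
      congr 1
      field_simp
      ring
  -- sequences
  set U : ℕ → ℂ := fun n => z n ^ (k + 1) / (‖z n‖ : ℂ) ^ (k + 1) with hU
  have hr : ∀ n, 0 < ‖z n‖ := fun n => norm_pos_iff.2 (hzne n)
  have hrc : ∀ n, (‖z n‖ : ℂ) ≠ 0 := fun n => by exact_mod_cast (hr n).ne'
  have hUz : ∀ n, z n ^ (k + 1) = ((‖z n‖ ^ (k + 1) : ℝ) : ℂ) * U n := by
    intro n
    have := hrc n
    simp only [hU]
    push_cast
    field_simp
  have hL := aux_log z hzne hlim
  have hF0 : ∀ i, (F 0 i).im = 0 := by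
    intro i
    have h1 : Tendsto (fun n => (F (z n) i).im) atTop (nhds (F 0 i).im) :=
      (Complex.continuous_im.tendsto _).comp ((hFi i).continuousAt.tendsto.comp hlim)
    simp only [hImF] at h1
    exact (tendsto_nhds_unique h1 tendsto_const_nhds)
  have hfz : ∀ i, Tendsto (fun n => U n * f (z n) i) atTop (nhds (u * f 0 i)) :=
    fun i => hu.mul ((hfi i).continuousAt.tendsto.comp hlim)
  have hFzn : ∀ᶠ n in atTop, ∀ i, F (z n) i - F 0 i
      = ((‖z n‖ ^ (k + 1) : ℝ) : ℂ) * (U n * f (z n) i) := by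
    filter_upwards [hlim.eventually hFf] with n hn i
    have := congrFun hn i
    simp only [Pi.sub_apply, Pi.smul_apply, smul_eq_mul] at this
    rw [this, hUz]; ring
  have him : ∀ᶠ n in atTop, ∀ i, (U n * f (z n) i).im = 0 := by
    filter_upwards [hFzn] with n hn i
    have := congrArg Complex.im (hn i)
    rw [Complex.sub_im, hImF, hF0, Complex.im_ofReal_mul] at this
    have hp : ‖z n‖ ^ (k + 1) ≠ 0 := (pow_pos (hr n) _).ne'
    simpa [hp, (hr n).ne', hzne n] using this.symm
  set X : Fin g → ℝ := fun i => (u * f 0 i).re with hX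
  have hXim : ∀ i, (u * f 0 i).im = 0 := by
    intro i
    have h1 : Tendsto (fun n => (U n * f (z n) i).im) atTop (nhds (u * f 0 i).im) :=
      (Complex.continuous_im.tendsto _).comp (hfz i)
    refine tendsto_nhds_unique h1 (tendsto_const_nhds.congr' ?_)
    filter_upwards [him] with n hn
    exact (hn i).symm
  have hXc : ∀ i, u * f 0 i = (X i : ℂ) := fun i => Complex.ext (by simp [hX]) (by simp [hXim i])
  have hX0 : X ≠ 0 := by
    intro h
    apply hf0
    funext i
    have h1 := hXc i
    rw [h] at h1
    have hu0 : u ≠ 0 := by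
      intro h; rw [h] at hu1; simp at hu1
    simpa [hu0] using h1
  have hx : ∀ i, Tendsto (fun n => (U n * f (z n) i).re) atTop (nhds (X i)) :=
    fun i => (Complex.continuous_re.tendsto _).comp (hfz i)
  have hNre : ∀ i, ∑ j, N i j * (F 0 j).re = 0 := by
    intro i
    have := congrArg Complex.re (hNF0 i)
    simpa [Complex.re_sum] using this
  -- exact formula for Im G along the sequence
  have hGn : ∀ᶠ n in atTop, ∀ i, (G (z n) i).im
      = ‖z n‖ ^ (k + 1) * ((Real.log ‖z n‖ / (2 * Real.pi))
        * ∑ j, N i j * (U n * f (z n) j).re) := by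
    filter_upwards [hFzn] with n hn i
    have e : ∑ j, N i j * (F (z n) j).re
        = ‖z n‖ ^ (k + 1) * ∑ j, N i j * (U n * f (z n) j).re := by
      have : ∑ j, N i j * (F (z n) j).re
          = ∑ j, N i j * (F (z n) j).re - ∑ j, N i j * (F 0 j).re := by rw [hNre, sub_zero]
      rw [this, ← Finset.sum_sub_distrib, Finset.mul_sum]
      refine Finset.sum_congr rfl fun j _ => ?_
      have := congrArg Complex.re (hn j)
      rw [Complex.sub_re, Complex.re_ofReal_mul] at this
      rw [← mul_sub, this]; ring
    rw [hImG, e]; ring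
  have hNx : ∀ i, Tendsto (fun n => ∑ j, N i j * (U n * f (z n) j).re) atTop
      (nhds (∑ j, N i j * X j)) :=
    fun i => tendsto_finsetSum _ fun j _ => (hx j).const_mul _
  have hr0 : Tendsto (fun n => ‖z n‖) atTop (nhds 0) := by simpa using hlim.norm
  have hG0 : ∀ i, (G 0 i).im = 0 := by
    intro i
    have h1 : Tendsto (fun n => (G (z n) i).im) atTop (nhds (G 0 i).im) :=
      (Complex.continuous_im.tendsto _).comp ((hGi i).continuousAt.tendsto.comp hlim)
    have h2 : Tendsto (fun n => ‖z n‖ * Real.log ‖z n‖) atTop (nhds 0) := by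
      have := (Real.continuous_mul_log.tendsto 0).comp hr0
      simpa [Function.comp_def] using this
    have h3 := (((hr0.pow k).mul h2).div_const (2 * Real.pi)).mul (hNx i)
    simp only [mul_zero, zero_div, zero_mul] at h3
    refine tendsto_nhds_unique h1 (h3.congr' ?_)
    filter_upwards [hGn] with n hn
    rw [hn i]; ring
  have hzp : Tendsto z atTop (nhdsWithin (0 : ℂ) {0}ᶜ) :=
    tendsto_nhdsWithin_iff.2 ⟨hlim, Eventually.of_forall fun n => hzne n⟩
  have hc : ∀ i, Tendsto (fun n => (Real.log ‖z n‖ / (2 * Real.pi))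
        * ∑ j, N i j * (U n * f (z n) j).re) atTop
      (nhds (∑ j, (η 0 i j).im * X j
        + (1 / (2 * Real.pi * (k + 1))) * ∑ j, N i j * X j)) := by
    intro i
    have h1 := hu.mul ((hGlim i).comp hzp)
    have h2 := (Complex.continuous_im.tendsto _).comp h1
    have e : (u * ((∑ j, η 0 i j * (((k : ℂ) + 1) * f 0 j)
        - (1 / (2 * (Real.pi : ℂ) * Complex.I)) * ∑ j, (N i j : ℂ) * f 0 j) / ((k : ℂ) + 1))).im
        = ∑ j, (η 0 i j).im * X j + (1 / (2 * Real.pi * (k + 1))) * ∑ j, N i j * X j := by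
      have e1 : u * ((∑ j, η 0 i j * (((k : ℂ) + 1) * f 0 j)
          - (1 / (2 * (Real.pi : ℂ) * Complex.I)) * ∑ j, (N i j : ℂ) * f 0 j) / ((k : ℂ) + 1))
          = ∑ j, η 0 i j * (X j : ℂ)
          + ((1 / (2 * Real.pi * (k + 1)) * ∑ j, N i j * X j : ℝ) : ℂ) * Complex.I := by
        have a1 : ∑ j, η 0 i j * (((k : ℂ) + 1) * f 0 j)
            = ((k : ℂ) + 1) * ∑ j, η 0 i j * f 0 j := by
          rw [Finset.mul_sum]
          exact Finset.sum_congr rfl fun j _ => by ring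
        have a2 : ∑ j, η 0 i j * (X j : ℂ) = u * ∑ j, η 0 i j * f 0 j := by
          rw [Finset.mul_sum]
          exact Finset.sum_congr rfl fun j _ => by rw [← hXc]; ring
        have a3 : ∑ j, (N i j : ℂ) * (X j : ℂ) = u * ∑ j, (N i j : ℂ) * f 0 j := by
          rw [Finset.mul_sum]
          exact Finset.sum_congr rfl fun j _ => by rw [← hXc]; ring
        push_cast
        rw [a1, a2, a3]
        have hI : (1 / (2 * (Real.pi : ℂ) * Complex.I)) = - (1 / (2 * (Real.pi : ℂ))) * Complex.I := by
          have := Complex.I_ne_zero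
          field_simp
          simp
        rw [hI]
        field_simp
        ring
      rw [e1, Complex.add_im, Complex.im_sum, Complex.im_ofReal_mul]
      simp
    rw [e] at h2
    refine h2.congr' ?_
    filter_upwards [hGn] with n hn
    have hp : ‖z n‖ ^ (k + 1) ≠ 0 := (pow_pos (hr n) _).ne'
    have e2 : U n * ((G (z n) i - G 0 i) / z n ^ (k + 1))
        = (((‖z n‖ ^ (k + 1))⁻¹ : ℝ) : ℂ) * (G (z n) i - G 0 i) := by
      have h3 := hzne n
      have h4 := hrc n
      simp only [hU]
      push_cast
      field_simp
    simp only [Function.comp_apply]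
    rw [e2, Complex.im_ofReal_mul, Complex.sub_im, hG0, hn i, sub_zero, inv_mul_cancel_left₀ hp]
  have hpair := tendsto_finsetSum Finset.univ fun i _ => (hx i).mul (hc i)
  set x : ℕ → Fin g → ℝ := fun n i => (U n * f (z n) i).re with hxdef
  have hQn : ∀ n, 0 ≤ ∑ i, x n i * ∑ j, N i j * x n j :=
    fun n => aux_psd ρ hρ η N hη hpos z hz hzne hlim (x n)
  have hpair' : Tendsto (fun n => -(-(Real.log ‖z n‖ / (2 * Real.pi))
      * ∑ i, x n i * ∑ j, N i j * x n j)) atTop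
      (nhds ((∑ i, X i * ∑ j, (η 0 i j).im * X j)
        + (1 / (2 * Real.pi * (k + 1))) * ∑ i, X i * ∑ j, N i j * X j)) := by
    have e : ∑ i, X i * (∑ j, (η 0 i j).im * X j
        + (1 / (2 * Real.pi * (k + 1))) * ∑ j, N i j * X j)
        = (∑ i, X i * ∑ j, (η 0 i j).im * X j)
        + (1 / (2 * Real.pi * (k + 1))) * ∑ i, X i * ∑ j, N i j * X j := by
      rw [Finset.mul_sum, ← Finset.sum_add_distrib]
      exact Finset.sum_congr rfl fun i _ => by ring
    rw [e] at hpair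
    refine hpair.congr fun n => ?_
    rw [neg_mul, neg_neg, Finset.mul_sum]
    refine Finset.sum_congr rfl fun i _ => ?_
    simp only [hxdef]
    ring
  have hQlim : Tendsto (fun n => ∑ i, x n i * ∑ j, N i j * x n j) atTop
      (nhds (∑ i, X i * ∑ j, N i j * X j)) :=
    tendsto_finsetSum _ fun i _ => (hx i).mul (hNx i)
  have hQ0 : ∑ i, X i * ∑ j, N i j * X j = 0 := by
    have h1 := (tendsto_inv_atTop_zero.comp hL).mul hpair'.neg
    rw [zero_mul] at h1
    refine tendsto_nhds_unique hQlim (h1.congr' ?_)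
    filter_upwards [hL.eventually (eventually_gt_atTop 0)] with n hn
    simp only [Function.comp_apply, neg_neg]
    rw [inv_mul_cancel_left₀ hn.ne']
  have hE : ∑ i, X i * ∑ j, (η 0 i j).im * X j ≤ 0 := by
    rw [hQ0, mul_zero, add_zero] at hpair'
    refine le_of_tendsto hpair' ?_
    filter_upwards [hL.eventually (eventually_gt_atTop 0)] with n hn
    have := mul_nonneg hn.le (hQn n)
    linarith
  have himφ : ∀ w, (∑ i, (X i : ℂ) * ∑ j, η w i j * (X j : ℂ)).im
      = ∑ i, X i * ∑ j, (η w i j).im * X j := by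
    intro w
    simp [Complex.im_sum, Complex.im_ofReal_mul]
  have hfin := aux_open ρ hρ (fun w => ∑ i, (X i : ℂ) * ∑ j, η w i j * (X j : ℂ)) ?_ ?_
  · simp only [himφ] at hfin
    linarith
  · intro w hw
    refine Finset.analyticAt_fun_sum _ fun i _ => analyticAt_const.mul
      (Finset.analyticAt_fun_sum _ fun j _ => (hη i j w hw).mul analyticAt_const)
  · intro w hw hw0
    have := aux_quad _ N _ (hpos w hw hw0) X hX0
    rw [hQ0, mul_zero, sub_zero] at this
    simpa only [himφ, Matrix.map_apply] using this

/-- Analytic core of §3.2 (Claim 3.3 in the nonsingular case): with `F`, `G` holomorphic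
coefficient vectors, `η` a holomorphic symmetric matrix, `𝒩` a real symmetric matrix
such that `𝒩 F(0) = 0`, `G' + (2πi z)⁻¹ 𝒩 F = η F'`, and `Im η - (log|z|/2π) 𝒩`
positive definite on the punctured disc, vanishing of `Im F` and of
`Im G - (log|z|/2π) 𝒩 Re F` along a sequence of nonzero points tending to `0`
forces `F` and `G` to be constant. -/
theorem stmt_11 (g : ℕ) (hg : 1 ≤ g) (ρ : ℝ) (hρ : 0 < ρ) (hρ1 : ρ ≤ 1)
    (F G : ℂ → Fin g → ℂ) (η : ℂ → Matrix (Fin g) (Fin g) ℂ)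
    (N : Matrix (Fin g) (Fin g) ℝ)
    (hF : AnalyticOnNhd ℂ F (ball 0 ρ)) (hG : AnalyticOnNhd ℂ G (ball 0 ρ))
    (hη : ∀ i j : Fin g, AnalyticOnNhd ℂ (fun w => η w i j) (ball 0 ρ))
    (hηs : ∀ z ∈ ball (0 : ℂ) ρ, (η z).IsSymm) (hNs : N.IsSymm)
    (hNF0 : (N.map (Complex.ofReal)).mulVec (F 0) = 0)
    (hode : ∀ z ∈ ball (0 : ℂ) ρ, z ≠ 0 →
      (fun i => deriv (fun w => G w i) z) +
        (1 / (2 * (Real.pi : ℂ) * Complex.I * z)) •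
          (N.map (Complex.ofReal)).mulVec (F z)
      = (η z).mulVec (fun j => deriv (fun w => F w j) z))
    (hpos : ∀ z ∈ ball (0 : ℂ) ρ, z ≠ 0 →
      (((η z).map Complex.im) - (Real.log ‖z‖ / (2 * Real.pi)) • N).PosDef)
    (z : ℕ → ℂ) (hz : ∀ n, z n ∈ ball (0 : ℂ) ρ) (hzne : ∀ n, z n ≠ 0)
    (hlim : Tendsto z atTop (nhds 0))
    (hImF : ∀ n, ∀ i, (F (z n) i).im = 0)
    (hImG : ∀ n, (fun i => (G (z n) i).im) -
      (Real.log ‖z n‖ / (2 * Real.pi)) • N.mulVec (fun j => (F (z n) j).re)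
      = (0 : Fin g → ℝ)) :
    ∀ w ∈ ball (0 : ℂ) ρ, F w = F 0 ∧ G w = G 0 := by
  have h0 : (0 : ℂ) ∈ ball (0 : ℂ) ρ := by simpa using hρ
  have hpre : IsPreconnected (ball (0 : ℂ) ρ) := (convex_ball _ _).isPreconnected
  have hNF0' : ∀ i, ∑ j, (N i j : ℂ) * F 0 j = 0 := fun i => by
    simpa [mulVec, dotProduct] using congrFun hNF0 i
  have hode' : ∀ z ∈ ball (0 : ℂ) ρ, z ≠ 0 → ∀ i,
      deriv (fun w => G w i) z +
        (1 / (2 * (Real.pi : ℂ) * Complex.I * z)) * ∑ j, (N i j : ℂ) * F z j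
      = ∑ j, η z i j * deriv (fun w => F w j) z := fun w hw hw0 i => by
    simpa only [mulVec, dotProduct, Pi.add_apply, Pi.smul_apply, smul_eq_mul, Matrix.map_apply]
      using congrFun (hode w hw hw0) i
  have hImG' : ∀ n i, (G (z n) i).im =
      (Real.log ‖z n‖ / (2 * Real.pi)) * ∑ j, N i j * (F (z n) j).re := fun n i => by
    have := congrFun (hImG n) i
    simp only [mulVec, dotProduct, Pi.sub_apply, Pi.smul_apply, smul_eq_mul, Pi.zero_apply] at this
    linarith
  have hFa : AnalyticAt ℂ (fun w => F w - F 0) 0 := (hF 0 h0).sub analyticAt_const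
  have hconst : ∀ᶠ w in nhds (0 : ℂ), F w - F 0 = 0 := by
    by_contra hcon
    obtain ⟨m, f, hf, hf0, hFf⟩ := hFa.exists_eventuallyEq_pow_smul_nonzero_iff.2 hcon
    simp only [sub_zero] at hFf
    obtain _ | k := m
    · have := hFf.self_of_nhds
      simp at this
      exact hf0 this.symm
    · obtain ⟨u, hu1, φ, hφ, hu⟩ := (isCompact_sphere (0 : ℂ) 1).tendsto_subseq
        (x := fun n => z n ^ (k + 1) / (‖z n‖ : ℂ) ^ (k + 1)) (fun n => by
          have : ‖z n‖ ≠ 0 := norm_ne_zero_iff.2 (hzne n)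
          simp [norm_pow, this, hzne n])
      exact aux_core g ρ hρ F G η N hF hG hη hNF0' hode' hpos (z ∘ φ) (fun n => hz _)
        (fun n => hzne _) (hlim.comp hφ.tendsto_atTop) (fun n => hImF _) (fun n => hImG' _)
        k f hf hf0 hFf u (by simpa using hu1) hu
  have hFeq : ∀ w ∈ ball (0 : ℂ) ρ, F w = F 0 := by
    have := hF.eqOn_of_preconnected_of_eventuallyEq (g := fun _ => F 0) analyticOnNhd_const hpre h0
      (by filter_upwards [hconst] with w hw using sub_eq_zero.1 hw)
    exact fun w hw => this hw
  intro w hw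
  refine ⟨hFeq w hw, funext fun i => ?_⟩
  have hGi : AnalyticOnNhd ℂ (fun w => G w i) (ball 0 ρ) :=
    fun y hy => analyticAt_pi_iff.1 (hG y hy) i
  have hd : ∀ y ∈ ball (0 : ℂ) ρ, y ≠ 0 → deriv (fun w => G w i) y = 0 := by
    intro y hy hy0
    have h1 := hode' y hy hy0 i
    have h2 : ∀ j, deriv (fun w => F w j) y = 0 := by
      intro j
      have e : (fun w => F w j) =ᶠ[nhds y] fun _ => F 0 j := by
        filter_upwards [isOpen_ball.mem_nhds hy] with v hv
        rw [hFeq v hv]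
      rw [e.deriv_eq]; simp
    simpa [hFeq y hy, hNF0' i, h2] using h1
  have hd0 : deriv (fun w => G w i) =ᶠ[nhds 0] fun _ => 0 := by
    rw [← ContinuousAt.eventuallyEq_nhds_iff_eventuallyEq_nhdsNE
      (hGi 0 h0).deriv.continuousAt continuousAt_const]
    filter_upwards [nhdsWithin_le_nhds (isOpen_ball.mem_nhds h0), self_mem_nhdsWithin]
      with y hy hy0 using hd y hy hy0
  refine isOpen_ball.is_const_of_deriv_eq_zero (f := fun w => G w i) hpre
    hGi.differentiableOn ?_ hw h0
  intro y hy
  by_cases hy0 : y = 0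
  · rw [hy0]; exact hd0.self_of_nhds
  · exact hd y hy hy0
end
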